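/- arXiv:2405.03270 — 3 statements merged into one kernel-verified Lean document; each statement's English description precedes it below -/
import Mathlib

section
/- Let D=(V,A) be a digraph, S a multiset of vertices in V, and M a matroid on S with rank function r_M. There exists a decomposition of A into an M-reachability-based packing of arborescences in D (i.e. an M-reachability-based packing using every arc of A) if and only if d⁻_A(Z) ≥ p̂(Z) for every petal Z of D, and Σ_{X∈𝒫} (r_M(S_{P_{X_I}}) − r_M(S_{X_W}) − d⁻_A(X_O)) ≤ (Σ_{v∈V} r_M(S_{P_v})) − |A| for every OW-laminar family 𝒫 ⊆ 𝒳 of generalized petal bisets. -/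
open Finset

attribute [local instance] Classical.propDecidable

section Defs

variable {V α : Type} [Fintype V] [DecidableEq V] [Fintype α] [DecidableEq α]

/-- One step along an arc of the arc set `B`, for a digraph given by tail and head maps. -/
def DStep (tl hd : α → V) (B : Finset α) (u w : V) : Prop :=
  ∃ a ∈ B, tl a = u ∧ hd a = w

/-- Reachability by a directed path using only arcs of `B`. -/
def DReach (tl hd : α → V) (B : Finset α) : V → V → Prop :=
  Relation.ReflTransGen (DStep tl hd B)

/-- In-degree of a vertex set `X`, counting arcs of `B` with tail outside `X` and head in `X`. -/
noncomputable def inDegB (tl hd : α → V) (B : Finset α) (X : Finset V) : ℕ :=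
  (B.filter fun a => tl a ∉ X ∧ hd a ∈ X).card

/-- `PReach X` is the set of vertices from which some vertex of `X` is reachable. -/
noncomputable def PReach (tl hd : α → V) (X : Finset V) : Finset V :=
  univ.filter fun u => ∃ w ∈ X, DReach tl hd univ u w

/-- A subatom: a non-empty set of pairwise mutually reachable vertices. -/
def IsSubatom (tl hd : α → V) (C : Finset V) : Prop :=
  C.Nonempty ∧ ∀ u ∈ C, ∀ w ∈ C, DReach tl hd univ u w

/-- An atom: a maximal subatom, i.e. a strongly connected component. -/
def IsAtomOf (tl hd : α → V) (C : Finset V) : Prop :=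
  IsSubatom tl hd C ∧ ∀ C', IsSubatom tl hd C' → C ⊆ C' → C' = C

/-- A petal: `Z` meets an atom `C`, `Z ⊆ P_C`, and no arc enters `Z - C`. -/
def IsPetal (tl hd : α → V) (Z : Finset V) : Prop :=
  ∃ C, IsAtomOf tl hd C ∧ (Z ∩ C).Nonempty ∧ Z ⊆ PReach tl hd C ∧
    inDegB tl hd univ (Z \ C) = 0

/-- The (unique) atom witnessing that `Z` is a petal. -/
noncomputable def petalAtom (tl hd : α → V) (Z : Finset V) : Finset V :=
  if h : IsPetal tl hd Z then h.choose else ∅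

/-- The core of a petal `Z`. -/
noncomputable def petalCore (tl hd : α → V) (Z : Finset V) : Finset V :=
  petalAtom tl hd Z ∩ Z

/-- An `R`-branching with vertex set `U` and arc set `F`: roots have in-degree 0,
every other vertex of `U` has in-degree exactly 1, and every vertex of `U` is
reachable from some root (equivalently, unique paths from the root set). -/
def IsBranching (tl hd : α → V) (F : Finset α) (R U : Finset V) : Prop :=
  R ⊆ U ∧ (∀ a ∈ F, tl a ∈ U ∧ hd a ∈ U) ∧
  (∀ a ∈ F, hd a ∉ R) ∧
  (∀ w ∈ U, w ∉ R → (F.filter fun a => hd a = w).card = 1) ∧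
  (∀ w ∈ U, ∃ s ∈ R, DReach tl hd F s w)

/-- An `s`-arborescence with vertex set `U` and arc set `F`. -/
def IsArbor (tl hd : α → V) (F : Finset α) (s : V) (U : Finset V) : Prop :=
  IsBranching tl hd F {s} U

end Defs

/-- A matroid on a finite ground set `σ`, given by its rank function. -/
structure RankFn (σ : Type) [DecidableEq σ] [Fintype σ] where
  r : Finset σ → ℕ
  r_empty : r ∅ = 0
  r_le_card : ∀ X, r X ≤ X.card
  r_mono : ∀ ⦃X Y : Finset σ⦄, X ⊆ Y → r X ≤ r Y
  r_submod : ∀ X Y, r (X ∪ Y) + r (X ∩ Y) ≤ r X + r Y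

/-- `B` is a basis of `T` for the rank function `r`. -/
def IsBasisOf {σ : Type} [DecidableEq σ] [Fintype σ]
    (r : Finset σ → ℕ) (B T : Finset σ) : Prop :=
  B ⊆ T ∧ r B = B.card ∧ r B = r T

/-- For a multiset `S` of vertices given by `loc : σ → V`, the sub-multiset `S_X`
of elements lying in `X`. -/
noncomputable def SX {V σ : Type} [DecidableEq V] [Fintype σ]
    (loc : σ → V) (X : Finset V) : Finset σ :=
  univ.filter fun s => loc s ∈ X

/-- The set function `p̂`: `p̂(Z) = r_M(S_{P_{C_Z}}) − r_M(S_Z)` for a petal `Z`,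
and `0` otherwise. -/
noncomputable def phat {V α σ : Type} [Fintype V] [DecidableEq V]
    [Fintype α] [DecidableEq α] [Fintype σ] [DecidableEq σ]
    (tl hd : α → V) (loc : σ → V) (M : RankFn σ) (Z : Finset V) : ℤ :=
  if IsPetal tl hd Z then
    (M.r (SX loc (PReach tl hd (petalAtom tl hd Z))) : ℤ) - M.r (SX loc Z)
  else 0

set_option linter.unusedSectionVars false

namespace RankFn

variable {σ : Type} [DecidableEq σ] [Fintype σ] (M : RankFn σ)

/-- `X` spans `s` when adding `s` to `X` does not increase the rank. -/
def Spans (X : Finset σ) (s : σ) : Prop := M.r (insert s X) ≤ M.r X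

variable {M} {X Y : Finset σ} {s : σ}

theorem spans_of_mem (h : s ∈ X) : M.Spans X s := by
  rw [Spans, insert_eq_of_mem h]

theorem Spans.mono (hXY : X ⊆ Y) (h : M.Spans X s) : M.Spans Y s := by
  have h1 := M.r_submod Y (insert s X)
  have h2 : insert s Y ⊆ Y ∪ insert s X := by grind
  have h3 : X ⊆ Y ∩ insert s X := by grind
  have := M.r_mono h2
  have := M.r_mono h3
  unfold Spans at *
  omega

theorem r_union_of_spans (h : ∀ s ∈ Y, M.Spans X s) : M.r (X ∪ Y) = M.r X := by
  induction Y using Finset.induction with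
  | empty => simp
  | insert a Y ha ih =>
    have h1 := ih fun s hs => h s (mem_insert_of_mem hs)
    have h2 : M.Spans (X ∪ Y) a := (h a (mem_insert_self _ _)).mono subset_union_left
    have h3 := M.r_mono (show X ⊆ X ∪ insert a Y from subset_union_left)
    rw [union_insert] at *
    unfold Spans at h2
    omega

theorem r_le_of_spans (h : ∀ s ∈ Y, M.Spans X s) : M.r Y ≤ M.r X :=
  (M.r_mono subset_union_right).trans (r_union_of_spans h).le

theorem Spans.trans (hs : M.Spans Y s) (h : ∀ t ∈ Y, M.Spans X t) : M.Spans X s := by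
  have h1 := r_union_of_spans h
  have h2 : M.Spans (X ∪ Y) s := hs.mono subset_union_right
  have h3 := M.r_mono (show insert s X ⊆ insert s (X ∪ Y) by grind)
  unfold Spans at *
  omega

/-- A subset of full rank spans. -/
theorem spans_of_r_le (hXY : X ⊆ Y) (hr : M.r Y ≤ M.r X) (hs : s ∈ Y) : M.Spans X s :=
  (M.r_mono (insert_subset hs hXY)).trans hr

/-- If the pair `X, Y` is modular up to a subset `Z` of `X ∩ Y`, then `Z` spans every element
spanned by both `X` and `Y`. -/
theorem spans_of_modular {Z : Finset σ} (hX : M.Spans X s) (hY : M.Spans Y s) (hZ : Z ⊆ X ∩ Y)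
    (h : M.r X + M.r Y ≤ M.r (X ∪ Y) + M.r Z) : M.Spans Z s := by
  have h1 := M.r_submod (insert s X) (insert s Y)
  have h2 := M.r_mono (show X ∪ Y ⊆ insert s X ∪ insert s Y by grind)
  have h3 := M.r_mono (show insert s Z ⊆ insert s X ∩ insert s Y by grind)
  unfold Spans at *
  omega

theorem r_insert_of_not_spans (h : ¬ M.Spans X s) : M.r (insert s X) = M.r X + 1 := by
  have h1 := M.r_submod X {s}
  have h2 := M.r_le_card {s}
  rw [union_comm, ← insert_eq] at h1
  rw [card_singleton] at h2
  unfold Spans at h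
  omega

theorem exists_mem_spans_erase (h : M.r X ≠ X.card) : ∃ s ∈ X, M.Spans (X.erase s) s := by
  by_contra! hcon
  have key : ∀ Y ⊆ X, M.r Y = Y.card := by
    intro Y
    induction Y using Finset.induction with
    | empty => simp [M.r_empty]
    | insert a Y ha ih =>
      intro hY
      have hsp : ¬ M.Spans Y a := fun hs =>
        hcon a (hY (mem_insert_self _ _)) (hs.mono (by grind))
      rw [r_insert_of_not_spans hsp, ih ((subset_insert _ _).trans hY), card_insert_of_notMem ha]
  exact h (key X subset_rfl)

end RankFn

/-- A family of vertex sets, each with a non-empty core, that is closed under union and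
intersection of core-intersecting members, together with a demand function that is supermodular
on such pairs. -/
structure CoreSystem (V : Type) [DecidableEq V] where
  mem : Finset V → Prop
  core : Finset V → Finset V
  demand : Finset V → ℤ
  core_subset : ∀ ⦃X⦄, mem X → core X ⊆ X
  core_nonempty : ∀ ⦃X⦄, mem X → (core X).Nonempty
  union_mem : ∀ ⦃X Y⦄, mem X → mem Y → (core X ∩ core Y).Nonempty → mem (X ∪ Y)
  inter_mem : ∀ ⦃X Y⦄, mem X → mem Y → (core X ∩ core Y).Nonempty → mem (X ∩ Y)
  core_union : ∀ ⦃X Y⦄, mem X → mem Y → (core X ∩ core Y).Nonempty →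
    core (X ∪ Y) = core X ∪ core Y
  core_inter : ∀ ⦃X Y⦄, mem X → mem Y → (core X ∩ core Y).Nonempty →
    core (X ∩ Y) = core X ∩ core Y
  core_inter_subset : ∀ ⦃X Y⦄, mem X → mem Y → (core X ∩ core Y).Nonempty →
    core X ∩ Y ⊆ core Y
  demand_add_le : ∀ ⦃X Y⦄, mem X → mem Y → (core X ∩ core Y).Nonempty →
    demand X + demand Y ≤ demand (X ∪ Y) + demand (X ∩ Y)

namespace CoreSystem

variable {V σ : Type} [DecidableEq V] [Fintype σ] [DecidableEq σ]
  (C : CoreSystem V) (M : RankFn σ) (loc : σ → V)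

/-- A member `X.1` of the system with a set `X.2` of elements located in it that contains every
element outside the core and every element of `N`. -/
def Admissible (N : Finset σ) (X : Finset V × Finset σ) : Prop :=
  C.mem X.1 ∧ X.2 ⊆ SX loc X.1 ∧ ∀ s, loc s ∈ X.1 → (loc s ∉ C.core X.1 ∨ s ∈ N) → s ∈ X.2

/-- `s` is located in the core of `X.1` and is missing from `X.2`. -/
def Covers (X : Finset V × Finset σ) (s : σ) : Prop := loc s ∈ C.core X.1 ∧ s ∉ X.2

/-- The demand of `X.1` that is left over by `X.2`. -/
def value (X : Finset V × Finset σ) : ℤ := C.demand X.1 - M.r X.2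

/-- Every finite admissible family covering each element outside `Dl` at most `m` times has
total value at most `m * k`. -/
def Bounded (N Dl : Finset σ) (m : ℕ) (k : ℤ) : Prop :=
  ∀ (ι : Type) [Fintype ι] (L : ι → Finset V × Finset σ), (∀ i, C.Admissible loc N (L i)) →
    (∀ s ∉ Dl, (univ.filter fun i => C.Covers loc (L i) s).card ≤ m) →
    ∑ i, C.value M (L i) ≤ m * k

variable {C M loc} {N Dl : Finset σ} {X Y : Finset V × Finset σ}

theorem Admissible.sup
    (hX : C.Admissible loc N X) (hY : C.Admissible loc N Y)
    (hXY : (C.core X.1 ∩ C.core Y.1).Nonempty) : C.Admissible loc N (X ⊔ Y) := by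
  obtain ⟨hX1, hX2, hX3⟩ := hX
  obtain ⟨hY1, hY2, hY3⟩ := hY
  refine ⟨C.union_mem hX1 hY1 hXY, ?_, ?_⟩
  · intro s hs
    have := @hX2 s
    have := @hY2 s
    simp only [SX, mem_filter, mem_univ, true_and, Prod.snd_sup, Prod.fst_sup, sup_eq_union,
      mem_union] at *
    tauto
  · intro s hs h
    have := hX3 s
    have := hY3 s
    simp only [Prod.snd_sup, Prod.fst_sup, sup_eq_union, C.core_union hX1 hY1 hXY,
      mem_union] at *
    tauto

theorem Admissible.inf
    (hX : C.Admissible loc N X) (hY : C.Admissible loc N Y)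
    (hXY : (C.core X.1 ∩ C.core Y.1).Nonempty) : C.Admissible loc N (X ⊓ Y) := by
  obtain ⟨hX1, hX2, hX3⟩ := hX
  obtain ⟨hY1, hY2, hY3⟩ := hY
  refine ⟨C.inter_mem hX1 hY1 hXY, ?_, ?_⟩
  · intro s hs
    have := @hX2 s
    have := @hY2 s
    simp only [SX, mem_filter, mem_univ, true_and, Prod.snd_inf, Prod.fst_inf, inf_eq_inter,
      mem_inter] at *
    tauto
  · intro s hs h
    have := hX3 s
    have := hY3 s
    have e1 := C.core_inter_subset hX1 hY1 hXY
    have e2 := C.core_inter_subset hY1 hX1 (by rwa [inter_comm])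
    have h1 := @e1 (loc s)
    have h2 := @e2 (loc s)
    simp only [Prod.snd_inf, Prod.fst_inf, inf_eq_inter, C.core_inter hX1 hY1 hXY,
      mem_inter] at *
    tauto

theorem covers_sup_add_covers_inf
    (hX : C.Admissible loc N X) (hY : C.Admissible loc N Y)
    (hXY : (C.core X.1 ∩ C.core Y.1).Nonempty) (s : σ) :
    (if C.Covers loc (X ⊔ Y) s then 1 else 0) + (if C.Covers loc (X ⊓ Y) s then 1 else 0) =
      (if C.Covers loc X s then 1 else 0) + (if C.Covers loc Y s then 1 else 0 : ℤ) := by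
  obtain ⟨hX1, hX2, hX3⟩ := hX
  obtain ⟨hY1, hY2, hY3⟩ := hY
  have e1 := C.core_inter_subset hX1 hY1 hXY
  have e2 := C.core_inter_subset hY1 hX1 (by rwa [inter_comm])
  have e3 := C.core_subset hX1
  have e4 := C.core_subset hY1
  have h1 := @e1 (loc s)
  have h2 := @e2 (loc s)
  have h3 := @hX2 s
  have h4 := @hY2 s
  have h5 := @e3 (loc s)
  have h6 := @e4 (loc s)
  simp only [SX, mem_filter, mem_univ, true_and, mem_inter] at h1 h2 h3 h4
  have k1 : loc s ∈ C.core X.1 → loc s ∉ C.core Y.1 → s ∉ Y.2 := by tauto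
  have k2 : loc s ∈ C.core Y.1 → loc s ∉ C.core X.1 → s ∉ X.2 := by tauto
  simp only [Covers, Prod.snd_inf, Prod.fst_inf, inf_eq_inter, C.core_inter hX1 hY1 hXY,
    Prod.snd_sup, Prod.fst_sup, sup_eq_union, C.core_union hX1 hY1 hXY, mem_inter, mem_union]
  clear h1 h2 h3 h4 h5 h6 hX2 hX3 hY2 hY3 e1 e2 e3 e4 hXY
  by_cases p1 : loc s ∈ C.core X.1 <;> by_cases p2 : loc s ∈ C.core Y.1 <;>
    by_cases q1 : s ∈ X.2 <;> by_cases q2 : s ∈ Y.2 <;> simp_all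

theorem value_add_value_le
    (hX : C.Admissible loc N X) (hY : C.Admissible loc N Y)
    (hXY : (C.core X.1 ∩ C.core Y.1).Nonempty) :
    C.value M X + C.value M Y ≤ C.value M (X ⊔ Y) + C.value M (X ⊓ Y) := by
  have h1 := C.demand_add_le hX.1 hY.1 hXY
  have h2 := M.r_submod X.2 Y.2
  simp only [value, Prod.snd_inf, Prod.fst_inf, inf_eq_inter, Prod.snd_sup, Prod.fst_sup,
    sup_eq_union]
  omega

theorem sq_card_lt (h1 : ¬ X ≤ Y) (h2 : ¬ Y ≤ X) :
    ((X.1.card + X.2.card) ^ 2 + (Y.1.card + Y.2.card) ^ 2 : ℤ) <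
      ((X ⊔ Y).1.card + (X ⊔ Y).2.card) ^ 2 + ((X ⊓ Y).1.card + (X ⊓ Y).2.card) ^ 2 := by
  have key : ∀ A B : Finset V × Finset σ, ¬ A ≤ B →
      B.1.card + B.2.card < (A ⊔ B).1.card + (A ⊔ B).2.card := by
    intro A B h
    have e1 : B.1 ⊆ A.1 ∪ B.1 := subset_union_right
    have e2 : B.2 ⊆ A.2 ∪ B.2 := subset_union_right
    have c1 := card_le_card e1
    have c2 := card_le_card e2
    by_contra hcon
    simp only [Prod.snd_sup, Prod.fst_sup, sup_eq_union] at hcon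
    have f1 := eq_of_subset_of_card_le e1 (by omega)
    have f2 := eq_of_subset_of_card_le e2 (by omega)
    exact h ⟨by rw [f1]; exact subset_union_left, by rw [f2]; exact subset_union_left⟩
  have k1 := key X Y h1
  have k2 := key Y X h2
  rw [sup_comm] at k2
  have e1 := card_union_add_card_inter X.1 Y.1
  have e2 := card_union_add_card_inter X.2 Y.2
  simp only [Prod.snd_inf, Prod.fst_inf, inf_eq_inter, Prod.snd_sup, Prod.fst_sup,
    sup_eq_union] at *
  zify at *
  nlinarith

theorem sum_update_update {ι β : Type} [Fintype ι] (L : ι → β) {i j : ι} (hij : i ≠ j) (x y : β)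
    (g : β → ℤ) :
    ∑ l, g (Function.update (Function.update L i x) j y l) + (g (L i) + g (L j)) =
      ∑ l, g (L l) + (g x + g y) := by
  have hj : j ∈ univ.erase i := mem_erase.2 ⟨hij.symm, mem_univ _⟩
  have h : ∀ f : ι → ℤ, ∑ l, f l = f i + (f j + ∑ l ∈ (univ.erase i).erase j, f l) := fun f => by
    rw [add_sum_erase _ _ hj, add_sum_erase _ _ (mem_univ i)]
  rw [h fun l => g (L l), h]
  have h2 : ∑ l ∈ (univ.erase i).erase j, g (Function.update (Function.update L i x) j y l) =
      ∑ l ∈ (univ.erase i).erase j, g (L l) := by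
    refine sum_congr rfl fun l hl => ?_
    simp only [mem_erase] at hl
    rw [Function.update_of_ne hl.1, Function.update_of_ne hl.2.1]
  rw [h2, Function.update_self, Function.update_of_ne hij, Function.update_self]
  ring

/-- Every admissible family can be uncrossed into one in which core-intersecting members are
comparable. -/
theorem exists_uncrossed [Fintype V] {ι : Type} [Fintype ι] (L : ι → Finset V × Finset σ) (m : ℕ)
    (hL : ∀ i, C.Admissible loc N (L i))
    (hm : ∀ s ∉ Dl, (univ.filter fun i => C.Covers loc (L i) s).card ≤ m) :
    ∃ L' : ι → Finset V × Finset σ, (∀ i, C.Admissible loc N (L' i)) ∧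
      (∀ s ∉ Dl, (univ.filter fun i => C.Covers loc (L' i) s).card ≤ m) ∧
      ∑ i, C.value M (L i) ≤ ∑ i, C.value M (L' i) ∧
      ∀ i j, (C.core (L' i).1 ∩ C.core (L' j).1).Nonempty → L' i ≤ L' j ∨ L' j ≤ L' i := by
  let G : Finset (ι → Finset V × Finset σ) := univ.filter fun L' =>
    (∀ i, C.Admissible loc N (L' i)) ∧
      (∀ s ∉ Dl, (univ.filter fun i => C.Covers loc (L' i) s).card ≤ m) ∧
      ∑ i, C.value M (L i) ≤ ∑ i, C.value M (L' i)
  have hG : G.Nonempty := ⟨L, by simpa [G] using ⟨hL, hm⟩⟩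
  obtain ⟨K, hK, hmax⟩ := exists_max_image G
    (fun K => ∑ i, (((K i).1.card + (K i).2.card) ^ 2 : ℤ)) hG
  simp only [G, mem_filter, mem_univ, true_and] at hK hmax
  obtain ⟨hK1, hK2, hK3⟩ := hK
  refine ⟨K, hK1, hK2, hK3, fun i j hij => ?_⟩
  by_contra! hcon
  have hne : i ≠ j := by
    rintro rfl
    exact hcon.1 le_rfl
  have hsum := sum_update_update K hne (K i ⊔ K j) (K i ⊓ K j)
  have hlt := sq_card_lt hcon.1 hcon.2
  have hle := hmax (Function.update (Function.update K i (K i ⊔ K j)) j (K i ⊓ K j)) ⟨?_, ?_, ?_⟩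
  · have := hsum fun X => (X.1.card + X.2.card) ^ 2
    linarith
  · intro l
    rcases eq_or_ne l j with rfl | hlj
    · rw [Function.update_self]
      exact (hK1 i).inf (hK1 l) hij
    · rw [Function.update_of_ne hlj]
      rcases eq_or_ne l i with rfl | hli
      · rw [Function.update_self]
        exact (hK1 l).sup (hK1 j) hij
      · rw [Function.update_of_ne hli]
        exact hK1 l
  · intro s hs
    have h1 := hsum fun X => if C.Covers loc X s then 1 else 0
    have h2 := covers_sup_add_covers_inf (hK1 i) (hK1 j) hij s
    have h3 := hK2 s hs
    simp only [sum_boole] at h1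
    zify at h3 ⊢
    linarith
  · have h1 := hsum (C.value M)
    have h2 := value_add_value_le (M := M) (hK1 i) (hK1 j) hij
    linarith

section Precedence

/-- The strict order on the indices of a family of core-intersecting members that refines the
order of the members. -/
def Prec (C : CoreSystem V) {ι : Type} [Fintype ι] (L : ι → Finset V × Finset σ) (i j : ι) :
    Prop :=
  (C.core (L i).1 ∩ C.core (L j).1).Nonempty ∧
    (L i < L j ∨ L i = L j ∧ Fintype.equivFin ι i < Fintype.equivFin ι j)

variable {ι : Type} [Fintype ι] {L : ι → Finset V × Finset σ} {i j l : ι}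

theorem Prec.le (h : C.Prec L i j) : L i ≤ L j := by
  rcases h.2 with h | h
  exacts [h.le, h.1.le]

theorem not_prec_self : ¬ C.Prec L i i := fun h => by
  rcases h.2 with h | h
  exacts [lt_irrefl _ h, lt_irrefl _ h.2]

theorem prec_or_prec (hne : i ≠ j) (hij : (C.core (L i).1 ∩ C.core (L j).1).Nonempty)
    (h : L i ≤ L j ∨ L j ≤ L i) : C.Prec L i j ∨ C.Prec L j i := by
  have hji : (C.core (L j).1 ∩ C.core (L i).1).Nonempty := by rwa [inter_comm]
  rcases eq_or_ne (L i) (L j) with heq | hne'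
  · rcases lt_or_gt_of_ne ((Fintype.equivFin ι).injective.ne hne) with hlt | hlt
    exacts [.inl ⟨hij, .inr ⟨heq, hlt⟩⟩, .inr ⟨hji, .inr ⟨heq.symm, hlt⟩⟩]
  · rcases h with h | h
    exacts [.inl ⟨hij, .inl (h.lt_of_ne hne')⟩, .inr ⟨hji, .inl (h.lt_of_ne hne'.symm)⟩]

theorem Prec.core_subset (hL : ∀ i, C.mem (L i).1) (h : C.Prec L i j) :
    C.core (L i).1 ⊆ C.core (L j).1 := fun _ hx =>
  C.core_inter_subset (hL i) (hL j) h.1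
    (mem_inter.2 ⟨hx, h.le.1 (C.core_subset (hL i) hx)⟩)

theorem Prec.trans (hL : ∀ i, C.mem (L i).1) (h : C.Prec L i j) (h' : C.Prec L j l) :
    C.Prec L i l := by
  refine ⟨?_, ?_⟩
  · obtain ⟨x, hx⟩ := C.core_nonempty (hL i)
    exact ⟨x, mem_inter.2 ⟨hx, h'.core_subset hL (h.core_subset hL hx)⟩⟩
  · rcases h.2 with h1 | h1
    · exact .inl (h1.trans_le h'.le)
    · rcases h'.2 with h2 | h2
      · exact .inl (h1.1 ▸ h2)
      · exact .inr ⟨h1.1.trans h2.1, h1.2.trans h2.2⟩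

end Precedence

/-- The bound for families covering each element at most once implies the bound for families
covering each element at most `m` times: an uncrossed family splits into `m` families of the
former kind according to the number of members above each member. -/
theorem Bounded.of_one [Fintype V] {k : ℤ} {m : ℕ} (hm : 0 < m) (h : C.Bounded M loc N Dl 1 k) :
    C.Bounded M loc N Dl m k := by
  intro ι _ L₀ hL₀ hcov₀
  obtain ⟨L, hL, hcov, hval, hcomp⟩ := exists_uncrossed (M := M) L₀ m hL₀ hcov₀
  refine hval.trans ?_
  have hmem := fun i => (hL i).1
  let depth : ι → ℕ := fun i => (univ.filter fun j => C.Prec L i j).card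
  have key : ∀ a b s, s ∉ Dl → C.Prec L a b → C.Covers loc (L a) s → C.Covers loc (L b) s →
      depth a % m = depth b % m → False := by
    intro a b s hs hab ha hb hmod
    have hsub : (univ.filter fun j => C.Prec L b j) ⊆ univ.filter fun j => C.Prec L a j := by
      intro j hj
      simp only [mem_filter, mem_univ, true_and] at hj ⊢
      exact hab.trans hmem hj
    have hcard := card_sdiff_add_card_eq_card hsub
    set Q := (univ.filter fun j => C.Prec L a j) \ univ.filter fun j => C.Prec L b j with hQ
    have hbQ : b ∈ Q := by simp [hQ, hab, not_prec_self]
    have hpos := card_pos.2 ⟨b, hbQ⟩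
    have hdvd : m ∣ Q.card := by
      have h1 : depth b ≡ depth b + Q.card [MOD m] := by
        rw [Nat.ModEq, ← hmod]
        congr 1
        simp only [depth]
        omega
      have h2 : depth b + 0 ≡ depth b + Q.card [MOD m] := h1
      exact (Nat.modEq_zero_iff_dvd.1 (Nat.ModEq.add_left_cancel' _ h2).symm)
    have hmQ := Nat.le_of_dvd hpos hdvd
    have haQ : a ∉ Q := by simp [hQ, not_prec_self]
    have hsub' : insert a Q ⊆ univ.filter fun i => C.Covers loc (L i) s := by
      intro j hj
      simp only [mem_filter, mem_univ, true_and]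
      rcases mem_insert.1 hj with rfl | hj
      · exact ha
      simp only [hQ, mem_sdiff, mem_filter, mem_univ, true_and] at hj
      have hsj := hj.1.core_subset hmem ha.1
      have hle : L j ≤ L b := by
        rcases eq_or_ne j b with rfl | hne
        · exact le_rfl
        have hcap : (C.core (L j).1 ∩ C.core (L b).1).Nonempty :=
          ⟨loc s, mem_inter.2 ⟨hsj, hb.1⟩⟩
        rcases prec_or_prec hne hcap (hcomp j b hcap) with h | h
        exacts [h.le, absurd h hj.2]
      exact ⟨hsj, fun h => hb.2 (hle.2 h)⟩
    have := card_le_card hsub'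
    have := hcov s hs
    rw [card_insert_of_notMem haQ] at *
    omega
  have hfib : ∀ t ∈ range m, ∑ i ∈ univ.filter (fun i => depth i % m = t), C.value M (L i) ≤ k := by
    intro t _
    have h1 := h {i // depth i % m = t} (fun i => L i) (fun i => hL i) ?_
    · rw [← sum_subtype_eq_sum_filter, subtype_univ]
      simpa using h1
    · intro s hs
      rw [card_le_one]
      intro a ha b hb
      simp only [mem_filter, mem_univ, true_and] at ha hb
      by_contra hne
      have hcap : (C.core (L a).1 ∩ C.core (L b).1).Nonempty :=
        ⟨loc s, mem_inter.2 ⟨ha.1, hb.1⟩⟩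
      rcases prec_or_prec (fun h => hne (Subtype.ext h)) hcap (hcomp _ _ hcap) with h | h
      · exact key _ _ s hs h ha hb (a.2.trans b.2.symm)
      · exact key _ _ s hs h hb ha (b.2.trans a.2.symm)
  calc ∑ i, C.value M (L i)
      = ∑ t ∈ range m, ∑ i ∈ univ.filter (fun i => depth i % m = t), C.value M (L i) :=
        (sum_fiberwise_of_maps_to (fun i _ => mem_range.2 (Nat.mod_lt _ hm)) _).symm
    _ ≤ ∑ t ∈ range m, k := sum_le_sum hfib
    _ = m * k := by simp

theorem card_filter_sum_prod {ι₁ ι₂ ι₃ : Type} [Fintype ι₁] [Fintype ι₂] [Fintype ι₃]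
    (p : ι₁ ⊕ ι₂ × ι₃ → Prop) :
    (univ.filter p).card = (univ.filter fun i => p (.inl i)).card +
      ∑ x, (univ.filter fun j => p (.inr (x, j))).card := by
  simp only [card_filter, Fintype.sum_sum_type, Fintype.sum_prod_type]

/-- An undecided element can either be discarded, or be chosen at the cost of lowering the
bound by one. -/
theorem Bounded.delete_or_contract [Fintype V] {k : ℤ} {e : σ}
    (h : C.Bounded M loc N Dl 1 k) :
    C.Bounded M loc N (insert e Dl) 1 k ∨ C.Bounded M loc (insert e N) Dl 1 (k - 1) := by
  by_contra! hcon
  obtain ⟨h1, h2⟩ := hcon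
  simp only [Bounded, not_forall, not_le, exists_prop] at h1 h2
  obtain ⟨ι₁, _, L₁, hL₁, hc₁, hv₁⟩ := h1
  obtain ⟨ι₂, _, L₂, hL₂, hc₂, hv₂⟩ := h2
  have hL₂' : ∀ i, C.Admissible loc N (L₂ i) := fun i =>
    ⟨(hL₂ i).1, (hL₂ i).2.1, fun s hs hs' => (hL₂ i).2.2 s hs
      (hs'.imp_right fun h => mem_insert_of_mem h)⟩
  have he₂ : ∀ i, ¬ C.Covers loc (L₂ i) e := fun i hi =>
    hi.2 ((hL₂ i).2.2 e (C.core_subset (hL₂ i).1 hi.1) (.inr (mem_insert_self _ _)))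
  obtain hc | ⟨c, hc⟩ : (univ.filter fun i => C.Covers loc (L₁ i) e).card = 0 ∨
      ∃ c, (univ.filter fun i => C.Covers loc (L₁ i) e).card = c + 1 := by
    cases (univ.filter fun i => C.Covers loc (L₁ i) e).card <;> simp
  · refine hv₁.not_ge (h ι₁ L₁ hL₁ fun s hs => ?_)
    by_cases hse : s = e
    · rw [hse, hc]
      exact zero_le_one
    · exact hc₁ s (by simp [hse, hs])
  · have hb := h.of_one c.succ_pos (ι₁ ⊕ Fin c × ι₂) (Sum.elim L₁ fun x => L₂ x.2) ?_ ?_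
    · simp only [Fintype.sum_sum_type, Fintype.sum_prod_type, Sum.elim_inl, Sum.elim_inr,
        sum_const, card_univ, Fintype.card_fin, nsmul_eq_mul] at hb
      push_cast at hb hv₁ hv₂
      have : (c : ℤ) * k ≤ c * ∑ i, C.value M (L₂ i) := by gcongr; linarith
      linarith
    · rintro (i | i)
      exacts [hL₁ i, hL₂' _]
    · intro s hs
      rw [card_filter_sum_prod]
      change (univ.filter fun i => C.Covers loc (L₁ i) s).card +
        ∑ _x : Fin c, (univ.filter fun j => C.Covers loc (L₂ j) s).card ≤ c + 1
      rw [sum_const, card_univ, Fintype.card_fin, smul_eq_mul]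
      by_cases hse : s = e
      · subst hse
        simp [hc, he₂]
      · have k1 := hc₁ s (by simp [hse, hs])
        have k2 := Nat.mul_le_mul_left c (hc₂ s hs)
        omega

/-- If the bound `k` holds, then at most `k` elements suffice to cover all demands. -/
theorem Bounded.exists_cover [Fintype V] {k : ℤ} (h : C.Bounded M loc N Dl 1 k) :
    ∃ T, N ⊆ T ∧ ((T \ N).card : ℤ) ≤ k ∧
      ∀ Z, C.mem Z → C.demand Z ≤ M.r (SX loc (Z \ C.core Z) ∪ (T ∩ SX loc Z)) := by
  induction hn : (univ \ (N ∪ Dl)).card generalizing N Dl k with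
  | zero =>
    have hk : 0 ≤ k := by simpa using h Empty (fun i => i.elim) (fun i => i.elim) (by simp)
    refine ⟨N, subset_rfl, by simpa using hk, fun Z hZ => ?_⟩
    by_contra! hcon
    have hb := h (Fin (k.toNat + 1)) (fun _ => (Z, SX loc (Z \ C.core Z) ∪ (N ∩ SX loc Z))) ?_ ?_
    · simp only [sum_const, card_univ, Fintype.card_fin, nsmul_eq_mul, value] at hb
      push_cast [Int.toNat_of_nonneg hk] at hb
      nlinarith
    · refine fun _ => ⟨hZ, ?_, ?_⟩
      · intro s
        simp only [SX, mem_union, mem_inter, mem_filter, mem_univ, true_and, mem_sdiff]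
        tauto
      · intro s
        simp only [SX, mem_union, mem_inter, mem_filter, mem_univ, true_and, mem_sdiff]
        tauto
    · intro s hs
      have hsN : s ∈ N := by
        have : s ∉ univ \ (N ∪ Dl) := by simp [card_eq_zero.1 hn]
        simpa [hs] using this
      rw [filter_false_of_mem]
      · simp
      · rintro _ _ ⟨h1, h2⟩
        refine h2 (mem_union_right _ (mem_inter.2 ⟨hsN, ?_⟩))
        simpa [SX] using C.core_subset hZ h1
  | succ n ih =>
    obtain ⟨e, he⟩ := card_pos.1 (n.succ_pos.trans_eq hn.symm)
    have hcard := card_erase_of_mem he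
    have heN : e ∉ N := by
      simp only [mem_sdiff, mem_univ, true_and, Finset.mem_union, not_or] at he
      exact he.1
    rcases h.delete_or_contract (e := e) with h | h
    · refine ih h ?_
      rw [union_insert, sdiff_insert]
      omega
    · obtain ⟨T, hT, hk, hZ⟩ := ih h (by rw [insert_union, sdiff_insert]; omega)
      refine ⟨T, (subset_insert _ _).trans hT, ?_, hZ⟩
      rw [sdiff_insert, card_erase_of_mem (by simp [heN, hT (mem_insert_self e N)])] at hk
      omega

/-- A bound over the families in which the larger of two core-intersecting members only keeps
the part of its core outside the smaller one implies the bound for all admissible families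
covering each element at most once. -/
theorem bounded_of_laminar [Fintype V] {k : ℤ} (h₀ : ∀ Z, C.mem Z → C.demand Z ≤ M.r (SX loc Z))
    (h : ∀ P : Finset (Finset V × Finset V),
      (∀ X ∈ P, C.mem X.1 ∧ X.2.Nonempty ∧ X.2 ⊆ C.core X.1) →
      (∀ X ∈ P, ∀ Y ∈ P, X ≠ Y → (C.core X.1 ∩ C.core Y.1).Nonempty →
        X.1 ⊆ Y.1 \ Y.2 ∨ Y.1 ⊆ X.1 \ X.2) →
      ∑ X ∈ P, (C.demand X.1 - M.r (SX loc (X.1 \ X.2))) ≤ k) :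
    C.Bounded M loc ∅ ∅ 1 k := by
  intro ι _ L₀ hL₀ hcov₀
  obtain ⟨L, hL, hcov, hval, hcomp⟩ := exists_uncrossed (M := M) L₀ 1 hL₀ hcov₀
  refine hval.trans ?_
  have hmem := fun i => (hL i).1
  let I : ι → Finset V := fun i =>
    C.core (L i).1 \ (univ.filter fun j => C.Prec L j i).biUnion fun j => (L j).1
  have hIsub : ∀ i, I i ⊆ C.core (L i).1 := fun i => sdiff_subset
  have hprec : ∀ i j, C.Prec L i j → (L i).1 ⊆ (L j).1 \ I j := by
    intro i j hij x hx
    simp only [I, mem_sdiff, mem_biUnion, mem_filter, mem_univ, true_and, not_and, not_not]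
    exact ⟨hij.le.1 hx, fun _ => ⟨i, hij, hx⟩⟩
  have hwall : ∀ i, SX loc ((L i).1 \ I i) ⊆ (L i).2 := by
    intro i s hs
    simp only [SX, mem_filter, mem_univ, true_and, mem_sdiff, I, mem_biUnion, not_and,
      not_not] at hs
    by_contra hsi
    by_cases hcore : loc s ∈ C.core (L i).1
    · obtain ⟨j, hji, hj⟩ := hs.2 hcore
      have hsj : loc s ∈ C.core (L j).1 := C.core_inter_subset (hmem i) (hmem j)
        (by rw [inter_comm]; exact hji.1) (mem_inter.2 ⟨hcore, hj⟩)
      have heq := card_le_one.1 (hcov s (notMem_empty s)) i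
        (by simpa using ⟨hcore, hsi⟩) j (by simpa using ⟨hsj, fun h => hsi (hji.le.2 h)⟩)
      subst heq
      exact not_prec_self hji
    · exact hsi ((hL i).2.2 s hs.1 (.inl hcore))
  have hle : ∀ i, C.value M (L i) ≤ C.demand (L i).1 - M.r (SX loc ((L i).1 \ I i)) := by
    intro i
    have := M.r_mono (hwall i)
    unfold value
    omega
  have hlam : ∀ i j, i ≠ j → (C.core (L i).1 ∩ C.core (L j).1).Nonempty →
      (L i).1 ⊆ (L j).1 \ I j ∨ (L j).1 ⊆ (L i).1 \ I i := fun i j hij hcap =>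
    (prec_or_prec hij hcap (hcomp i j hcap)).imp (hprec i j) (hprec j i)
  let f : ι → Finset V × Finset V := fun i => ((L i).1, I i)
  let J := univ.filter fun i => (I i).Nonempty
  have hinj : Set.InjOn f J := by
    intro i hi j _ hij
    simp only [f, Prod.mk.injEq] at hij
    by_contra hne
    obtain ⟨x, hx⟩ : (I i).Nonempty := by simpa [J] using hi
    have hxc := hIsub i hx
    have hxL := C.core_subset (hmem i) hxc
    rcases hlam i j hne ⟨x, by rw [← hij.1, inter_self]; exact hxc⟩ with h1 | h1
    · exact (mem_sdiff.1 (h1 hxL)).2 (hij.2 ▸ hx)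
    · exact (mem_sdiff.1 (h1 (hij.1 ▸ hxL))).2 hx
  have hP := h (J.image f) ?_ ?_
  · rw [sum_image hinj] at hP
    calc ∑ i, C.value M (L i) ≤ ∑ i ∈ J, C.value M (L i) := by
          rw [← sum_filter_add_sum_filter_not univ (fun i => (I i).Nonempty),
            add_le_iff_nonpos_right]
          refine sum_nonpos fun i hi => (hle i).trans ?_
          rw [mem_filter, not_nonempty_iff_eq_empty] at hi
          rw [hi.2, sdiff_empty]
          have := h₀ _ (hmem i)
          omega
      _ ≤ ∑ i ∈ J, (C.demand (f i).1 - M.r (SX loc ((f i).1 \ (f i).2))) :=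
          sum_le_sum fun i _ => hle i
      _ ≤ (1 : ℕ) * k := by simpa using hP
  · simp only [mem_image, forall_exists_index, and_imp, forall_apply_eq_imp_iff₂]
    intro i hi
    exact ⟨hmem i, by simpa [J] using hi, hIsub i⟩
  · simp only [mem_image, forall_exists_index, and_imp, forall_apply_eq_imp_iff₂]
    intro i _ j _ hne
    exact hlam i j fun h => hne (h ▸ rfl)

end CoreSystem

section Petals

variable {V α : Type} [Fintype V] [DecidableEq V] [Fintype α] [DecidableEq α] {tl hd : α → V}
  {C C' X Y Z Z' : Finset V} {u v w : V}

theorem mem_PReach : u ∈ PReach tl hd X ↔ ∃ w ∈ X, DReach tl hd univ u w := by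
  simp [PReach]

theorem dReach_arc (a : α) : DReach tl hd univ (tl a) (hd a) :=
  .single ⟨a, mem_univ a, rfl, rfl⟩

theorem subset_PReach : X ⊆ PReach tl hd X := fun x hx => mem_PReach.2 ⟨x, hx, .refl⟩

theorem mem_PReach_of_dReach (h : DReach tl hd univ u w) (hw : w ∈ PReach tl hd X) :
    u ∈ PReach tl hd X := by
  obtain ⟨x, hx, hwx⟩ := mem_PReach.1 hw
  exact mem_PReach.2 ⟨x, hx, Relation.ReflTransGen.trans h hwx⟩

theorem inDegB_eq_zero : inDegB tl hd univ X = 0 ↔ ∀ a, hd a ∈ X → tl a ∈ X := by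
  simp only [inDegB, card_eq_zero, filter_eq_empty_iff, mem_univ, true_implies]
  exact forall_congr' fun a => by tauto

theorem mem_of_dReach (hX : inDegB tl hd univ X = 0) (h : DReach tl hd univ u w) (hw : w ∈ X) :
    u ∈ X := by
  induction h using Relation.ReflTransGen.head_induction_on with
  | refl => exact hw
  | head h _ ih =>
    obtain ⟨a, -, rfl, rfl⟩ := h
    exact inDegB_eq_zero.1 hX a ih

theorem PReach_subset (hX : inDegB tl hd univ X = 0) (h : v ∈ X) : PReach tl hd {v} ⊆ X := by
  intro u hu
  simp only [mem_PReach, mem_singleton, exists_eq_left] at hu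
  exact mem_of_dReach hX hu h

theorem inDegB_PReach : inDegB tl hd univ (PReach tl hd X) = 0 :=
  inDegB_eq_zero.2 fun a ha => mem_PReach_of_dReach (dReach_arc a) ha

theorem inDegB_submod (B : Finset α) (X Y : Finset V) :
    inDegB tl hd B (X ∪ Y) + inDegB tl hd B (X ∩ Y) ≤ inDegB tl hd B X + inDegB tl hd B Y := by
  simp only [inDegB, card_filter, ← sum_add_distrib]
  refine sum_le_sum fun a _ => ?_
  simp only [mem_union, mem_inter]
  by_cases h1 : tl a ∈ X <;> by_cases h2 : tl a ∈ Y <;> by_cases h3 : hd a ∈ X <;>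
    by_cases h4 : hd a ∈ Y <;> simp [h1, h2, h3, h4]

theorem IsAtomOf.mem_iff (hC : IsAtomOf tl hd C) (hu : u ∈ C) :
    w ∈ C ↔ DReach tl hd univ u w ∧ DReach tl hd univ w u := by
  refine ⟨fun hw => ⟨hC.1.2 u hu w hw, hC.1.2 w hw u hu⟩, fun ⟨h1, h2⟩ => ?_⟩
  have h := hC.2 (insert w C) ⟨insert_nonempty _ _, ?_⟩ (subset_insert _ _)
  · rw [← h]
    exact mem_insert_self _ _
  · have key : ∀ x ∈ insert w C, DReach tl hd univ x u ∧ DReach tl hd univ u x := by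
      intro x hx
      rcases mem_insert.1 hx with rfl | hx
      exacts [⟨h2, h1⟩, ⟨hC.1.2 x hx u hu, hC.1.2 u hu x hx⟩]
    exact fun x hx y hy => Relation.ReflTransGen.trans (key x hx).1 (key y hy).2

theorem IsAtomOf.eq_of_mem (hC : IsAtomOf tl hd C) (hC' : IsAtomOf tl hd C') (h : u ∈ C)
    (h' : u ∈ C') : C = C' := by
  ext w
  rw [hC.mem_iff h, hC'.mem_iff h']

theorem exists_atom (tl hd : α → V) (v : V) : ∃ C, IsAtomOf tl hd C ∧ v ∈ C := by
  refine ⟨univ.filter fun u => DReach tl hd univ u v ∧ DReach tl hd univ v u,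
    ⟨⟨⟨v, ?_⟩, ?_⟩, ?_⟩, ?_⟩
  · exact mem_filter.2 ⟨mem_univ _, .refl, .refl⟩
  · intro u hu w hw
    simp only [mem_filter, mem_univ, true_and] at hu hw
    exact Relation.ReflTransGen.trans hu.1 hw.2
  · intro C' hC' hsub
    refine subset_antisymm (fun u hu => ?_) hsub
    have hv : v ∈ C' := hsub (mem_filter.2 ⟨mem_univ _, .refl, .refl⟩)
    simpa using ⟨hC'.2 u hu v hv, hC'.2 v hv u hu⟩
  · exact mem_filter.2 ⟨mem_univ _, .refl, .refl⟩

theorem IsAtomOf.PReach_eq (hC : IsAtomOf tl hd C) (hX : X.Nonempty) (hXC : X ⊆ C) :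
    PReach tl hd X = PReach tl hd C := by
  obtain ⟨x, hx⟩ := hX
  ext u
  simp only [mem_PReach]
  constructor
  · rintro ⟨w, hw, h⟩
    exact ⟨w, hXC hw, h⟩
  · rintro ⟨w, hw, h⟩
    exact ⟨x, hx, Relation.ReflTransGen.trans h (hC.1.2 w hw x (hXC hx))⟩

/-- `Z` is a petal with atom `C`. -/
def IsPetalAt (tl hd : α → V) (C Z : Finset V) : Prop :=
  IsAtomOf tl hd C ∧ (Z ∩ C).Nonempty ∧ Z ⊆ PReach tl hd C ∧ inDegB tl hd univ (Z \ C) = 0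

theorem IsPetalAt.eq (h : IsPetalAt tl hd C Z) (h' : IsPetalAt tl hd C' Z) : C = C' := by
  by_contra hne
  obtain ⟨hC, ⟨y, hy⟩, -, hZ⟩ := h
  obtain ⟨hC', ⟨x, hx⟩, hsub, -⟩ := h'
  rw [mem_inter] at hx hy
  have hxC : x ∉ C := fun h => hne (hC.eq_of_mem hC' h hx.2)
  obtain ⟨w, hw, hyw⟩ := mem_PReach.1 (hsub hy.1)
  have hyx : DReach tl hd univ y x := Relation.ReflTransGen.trans hyw (hC'.1.2 w hw x hx.2)
  exact (mem_sdiff.1 (mem_of_dReach hZ hyx (mem_sdiff.2 ⟨hx.1, hxC⟩))).2 hy.2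

theorem IsPetal.isPetalAt (h : IsPetal tl hd Z) : IsPetalAt tl hd (petalAtom tl hd Z) Z := by
  rw [petalAtom, dif_pos h]
  exact h.choose_spec

theorem IsPetalAt.isPetal (h : IsPetalAt tl hd C Z) : IsPetal tl hd Z := ⟨C, h⟩

theorem IsPetalAt.petalAtom_eq (h : IsPetalAt tl hd C Z) : petalAtom tl hd Z = C :=
  h.isPetal.isPetalAt.eq h

theorem IsPetalAt.petalCore_eq (h : IsPetalAt tl hd C Z) : petalCore tl hd Z = C ∩ Z := by
  rw [petalCore, h.petalAtom_eq]

theorem IsPetalAt.union (h : IsPetalAt tl hd C Z) (h' : IsPetalAt tl hd C Z') :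
    IsPetalAt tl hd C (Z ∪ Z') := by
  refine ⟨h.1, h.2.1.mono (inter_subset_inter_right subset_union_left),
    union_subset h.2.2.1 h'.2.2.1, ?_⟩
  have := inDegB_submod (tl := tl) (hd := hd) univ (Z \ C) (Z' \ C)
  rw [← union_sdiff_distrib, h.2.2.2, h'.2.2.2] at this
  omega

theorem IsPetalAt.inter (h : IsPetalAt tl hd C Z) (h' : IsPetalAt tl hd C Z')
    (hne : (Z ∩ Z' ∩ C).Nonempty) : IsPetalAt tl hd C (Z ∩ Z') := by
  refine ⟨h.1, hne, inter_subset_left.trans h.2.2.1, ?_⟩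
  have := inDegB_submod (tl := tl) (hd := hd) univ (Z \ C) (Z' \ C)
  rw [show Z \ C ∩ (Z' \ C) = (Z ∩ Z') \ C by grind, h.2.2.2, h'.2.2.2] at this
  omega

theorem IsAtomOf.isPetalAt_PReach (hC : IsAtomOf tl hd C) :
    IsPetalAt tl hd C (PReach tl hd C) := by
  obtain ⟨x, hx⟩ := hC.1.1
  refine ⟨hC, ⟨x, mem_inter.2 ⟨subset_PReach hx, hx⟩⟩, subset_rfl, inDegB_eq_zero.2 fun a ha => ?_⟩
  rw [mem_sdiff] at ha ⊢
  refine ⟨mem_PReach_of_dReach (dReach_arc a) ha.1, fun htl => ha.2 ?_⟩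
  obtain ⟨w, hw, h⟩ := mem_PReach.1 ha.1
  exact (hC.mem_iff htl).2
    ⟨dReach_arc a, Relation.ReflTransGen.trans h (hC.1.2 w hw _ htl)⟩

/-- Petals whose cores intersect have the same atom. -/
theorem isPetalAt_of_core_inter (h : IsPetal tl hd Z) (h' : IsPetal tl hd Z')
    (hne : (petalCore tl hd Z ∩ petalCore tl hd Z').Nonempty) :
    ∃ C, IsPetalAt tl hd C Z ∧ IsPetalAt tl hd C Z' ∧ (Z ∩ Z' ∩ C).Nonempty := by
  obtain ⟨x, hx⟩ := hne
  simp only [petalCore, mem_inter] at hx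
  have heq := h.isPetalAt.1.eq_of_mem h'.isPetalAt.1 hx.1.1 hx.2.1
  exact ⟨_, h.isPetalAt, heq ▸ h'.isPetalAt, x, by simp [hx]⟩

/-- The petals of a digraph, with the demand `r_M(S_{P_C}) - d⁻(Z)` of a petal `Z` with
atom `C`. -/
noncomputable def petalSystem {σ : Type} [Fintype σ] [DecidableEq σ] (tl hd : α → V)
    (loc : σ → V) (M : RankFn σ) : CoreSystem V where
  mem := IsPetal tl hd
  core := petalCore tl hd
  demand Z := (M.r (SX loc (PReach tl hd (petalAtom tl hd Z))) : ℤ) - inDegB tl hd univ Z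
  core_subset _ _ := inter_subset_right
  core_nonempty X hX := by
    rw [petalCore, inter_comm]
    exact hX.isPetalAt.2.1
  union_mem X Y hX hY hXY := by
    obtain ⟨C, h, h', -⟩ := isPetalAt_of_core_inter hX hY hXY
    exact (h.union h').isPetal
  inter_mem X Y hX hY hXY := by
    obtain ⟨C, h, h', hne⟩ := isPetalAt_of_core_inter hX hY hXY
    exact (h.inter h' hne).isPetal
  core_union X Y hX hY hXY := by
    obtain ⟨C, h, h', -⟩ := isPetalAt_of_core_inter hX hY hXY
    rw [h.petalCore_eq, h'.petalCore_eq, (h.union h').petalCore_eq, inter_union_distrib_left]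
  core_inter X Y hX hY hXY := by
    obtain ⟨C, h, h', hne⟩ := isPetalAt_of_core_inter hX hY hXY
    rw [h.petalCore_eq, h'.petalCore_eq, (h.inter h' hne).petalCore_eq, inter_inter_distrib_left]
  core_inter_subset X Y hX hY hXY := by
    obtain ⟨C, h, h', -⟩ := isPetalAt_of_core_inter hX hY hXY
    rw [h.petalCore_eq, h'.petalCore_eq]
    grind
  demand_add_le X Y hX hY hXY := by
    obtain ⟨C, h, h', hne⟩ := isPetalAt_of_core_inter hX hY hXY
    rw [h.petalAtom_eq, h'.petalAtom_eq, (h.inter h' hne).petalAtom_eq,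
      (h.union h').petalAtom_eq]
    have := inDegB_submod (tl := tl) (hd := hd) univ X Y
    omega

end Petals

section Cover

variable {V α σ : Type} [Fintype V] [DecidableEq V] [Fintype α] [DecidableEq α]
  [Fintype σ] [DecidableEq σ] {tl hd : α → V} {loc : σ → V} {M : RankFn σ} {C X Y Z : Finset V}
  {T : Finset σ} {s : σ} {u v : V}

theorem mem_SX : s ∈ SX loc X ↔ loc s ∈ X := by
  simp [SX]

theorem SX_mono (h : X ⊆ Y) : SX loc X ⊆ SX loc Y := fun _ hs => mem_SX.2 (h (mem_SX.1 hs))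

theorem IsAtomOf.PReach_singleton (hC : IsAtomOf tl hd C) (hv : v ∈ C) :
    PReach tl hd {v} = PReach tl hd C :=
  hC.PReach_eq (singleton_nonempty v) (singleton_subset_iff.2 hv)

theorem IsPetalAt.PReach_subset_sdiff (h : IsPetalAt tl hd C Z) (hu : u ∈ Z) (huC : u ∉ C) :
    PReach tl hd {u} ⊆ Z \ C :=
  PReach_subset h.2.2.2 (mem_sdiff.2 ⟨hu, huC⟩)

theorem IsAtomOf.card_PReach_lt (hC : IsAtomOf tl hd C) (hv : v ∈ C) (hu : u ∈ PReach tl hd C)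
    (huC : u ∉ C) : (PReach tl hd {u}).card < (PReach tl hd {v}).card := by
  refine card_lt_card ⟨?_, fun hsub => ?_⟩
  · rw [hC.PReach_singleton hv]
    exact (hC.isPetalAt_PReach.PReach_subset_sdiff hu huC).trans sdiff_subset
  · exact (mem_sdiff.1 (hC.isPetalAt_PReach.PReach_subset_sdiff hu huC
      (hsub (subset_PReach (mem_singleton_self v))))).2 hv

theorem spans_of_cover
    (hT : ∀ Z, IsPetal tl hd Z → (petalSystem tl hd loc M).demand Z ≤
      M.r (SX loc (Z \ petalCore tl hd Z) ∪ T ∩ SX loc Z)) (v : V)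
    (hs : s ∈ SX loc (PReach tl hd {v})) : M.Spans (T ∩ SX loc (PReach tl hd {v})) s := by
  induction h : (PReach tl hd {v}).card using Nat.strong_induction_on generalizing v s with
  | _ n ih =>
    obtain ⟨C, hC, hv⟩ := exists_atom tl hd v
    have hP := hC.isPetalAt_PReach
    have hlt := fun u => hC.card_PReach_lt (u := u) hv
    rw [h] at hlt
    have hdem := hT _ hP.isPetal
    simp only [petalSystem, hP.petalAtom_eq, hP.petalCore_eq, inDegB_PReach] at hdem
    rw [hC.PReach_singleton hv] at hs ⊢
    refine RankFn.Spans.trans (RankFn.spans_of_r_le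
      (X := SX loc (PReach tl hd C \ (C ∩ PReach tl hd C)) ∪ T ∩ SX loc (PReach tl hd C))
      (Y := SX loc (PReach tl hd C)) ?_ ?_ hs) ?_
    · exact union_subset (SX_mono sdiff_subset) inter_subset_right
    · exact_mod_cast (by simpa using hdem)
    · intro t ht
      rcases mem_union.1 ht with ht | ht
      · have ht := mem_SX.1 ht
        rw [mem_sdiff, mem_inter] at ht
        refine RankFn.Spans.mono ?_ (ih _ (hlt (loc t) ht.1 (by tauto)) (loc t)
          (mem_SX.2 (subset_PReach (mem_singleton_self _))) rfl)
        exact inter_subset_inter_left (SX_mono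
          ((hP.PReach_subset_sdiff ht.1 (by tauto)).trans sdiff_subset))
      · exact RankFn.spans_of_mem ht

theorem demand_le_of_cover
    (hT : ∀ Z, IsPetal tl hd Z → (petalSystem tl hd loc M).demand Z ≤
      M.r (SX loc (Z \ petalCore tl hd Z) ∪ T ∩ SX loc Z)) (hZ : IsPetal tl hd Z) :
    (petalSystem tl hd loc M).demand Z ≤ M.r (T ∩ SX loc Z) := by
  have h := hT Z hZ
  rwa [union_comm, RankFn.r_union_of_spans] at h
  intro s hs
  have hs := mem_SX.1 hs
  rw [mem_sdiff, petalCore, mem_inter] at hs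
  exact RankFn.Spans.mono (inter_subset_inter_left (SX_mono
    ((hZ.isPetalAt.PReach_subset_sdiff hs.1 (by tauto)).trans sdiff_subset)))
    (spans_of_cover hT (loc s) (mem_SX.2 (subset_PReach (mem_singleton_self _))))

theorem exists_independent_cover (p : Finset V → Prop) (d : Finset V → ℤ)
    (hT : ∀ Z, p Z → d Z ≤ M.r (T ∩ SX loc Z)) :
    ∃ T' ⊆ T, (∀ Z, p Z → d Z ≤ M.r (T' ∩ SX loc Z)) ∧
      ∀ v, M.r (T' ∩ SX loc {v}) = (T' ∩ SX loc {v}).card := by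
  induction T using Finset.strongInduction with
  | H T ih =>
    by_cases hind : ∀ v, M.r (T ∩ SX loc {v}) = (T ∩ SX loc {v}).card
    · exact ⟨T, subset_rfl, hT, hind⟩
    push Not at hind
    obtain ⟨v, hv⟩ := hind
    obtain ⟨s, hs, hspan⟩ := RankFn.exists_mem_spans_erase hv
    rw [mem_inter, mem_SX, mem_singleton] at hs
    obtain ⟨T', hT', h⟩ := ih (T.erase s) (erase_ssubset hs.1) fun Z hZ => by
      refine (hT Z hZ).trans (Nat.cast_le.2 ?_)
      by_cases hvZ : v ∈ Z
      · have hspan' : M.Spans (T.erase s ∩ SX loc Z) s := by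
          refine RankFn.Spans.mono (fun t ht => ?_) hspan
          simp only [mem_erase, mem_inter, mem_SX, mem_singleton] at ht ⊢
          exact ⟨⟨ht.1, ht.2.1⟩, ht.2.2 ▸ hvZ⟩
        refine le_trans (M.r_mono fun t ht => ?_) hspan'
        simp only [mem_insert, mem_erase, mem_inter] at ht ⊢
        tauto
      · refine M.r_mono fun t ht => ?_
        rw [mem_inter, mem_SX] at ht
        refine mem_inter.2 ⟨mem_erase.2 ⟨?_, ht.1⟩, mem_SX.2 ht.2⟩
        rintro rfl
        exact hvZ (hs.2 ▸ ht.2)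
    exact ⟨T', hT'.trans (erase_subset _ _), h⟩

end Cover

section Packing

variable {V α σ : Type} [Fintype V] [DecidableEq V] [Fintype α] [DecidableEq α]
  [Fintype σ] [DecidableEq σ] {tl hd : α → V} {loc : σ → V} {M : RankFn σ} {C C' X Y Z : Finset V}
  {T : Finset σ} {s : σ} {u v w : V} {a : α} {B : Finset α} {F : σ → Finset α} {U : σ → Finset V}

theorem DReach.mono {B B' : Finset α} (h : B ⊆ B') (hr : DReach tl hd B u w) :
    DReach tl hd B' u w :=
  Relation.ReflTransGen.mono (r := DStep tl hd B) (p := DStep tl hd B')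
    (fun _ _ ⟨a, ha, h1⟩ => ⟨a, h ha, h1⟩) u w hr

theorem isArbor_singleton (tl hd : α → V) (v : V) : IsArbor tl hd ∅ v {v} :=
  ⟨subset_rfl, by simp, by simp, fun w hw hw' => absurd hw hw',
    fun w hw => ⟨w, hw, .refl⟩⟩

theorem IsArbor.root_mem {G : Finset α} {W : Finset V} (h : IsArbor tl hd G v W) : v ∈ W :=
  h.1 (mem_singleton_self v)

theorem IsArbor.insert {G : Finset α} {W : Finset V} (h : IsArbor tl hd G v W) (htl : tl a ∈ W)
    (hhd : hd a ∉ W) : IsArbor tl hd (insert a G) v (insert (hd a) W) := by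
  have hv := h.root_mem
  obtain ⟨h1, h2, h3, h4, h5⟩ := h
  refine ⟨h1.trans (subset_insert _ _), fun b hb => ?_, fun b hb => ?_, fun w hw hwv => ?_,
    fun w hw => ?_⟩
  · rcases mem_insert.1 hb with rfl | hb
    · exact ⟨mem_insert_of_mem htl, mem_insert_self _ _⟩
    · exact ⟨mem_insert_of_mem (h2 b hb).1, mem_insert_of_mem (h2 b hb).2⟩
  · rcases mem_insert.1 hb with rfl | hb
    · rw [mem_singleton]
      exact fun he => hhd (he ▸ hv)
    · exact h3 b hb
  · rcases mem_insert.1 hw with rfl | hw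
    · rw [card_eq_one]
      refine ⟨a, ?_⟩
      ext b
      simp only [mem_filter, mem_insert, mem_singleton]
      refine ⟨fun ⟨hb, he⟩ => hb.resolve_right fun hb => hhd (he ▸ (h2 b hb).2), ?_⟩
      rintro rfl
      simp
    · rw [filter_insert, if_neg fun he : hd a = w => hhd (he ▸ hw)]
      exact h4 w hw hwv
  · have key : ∀ w ∈ W, ∃ s ∈ ({v} : Finset V), DReach tl hd (Insert.insert a G) s w :=
        fun w hw => by
      obtain ⟨s, hs, hr⟩ := h5 w hw
      exact ⟨s, hs, hr.mono (subset_insert _ _)⟩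
    rcases mem_insert.1 hw with rfl | hw
    · obtain ⟨s, hs, hr⟩ := key _ htl
      exact ⟨s, hs, Relation.ReflTransGen.tail hr ⟨a, mem_insert_self _ _, rfl, rfl⟩⟩
    · exact key w hw

theorem IsArbor.dReach {G : Finset α} {W : Finset V} (h : IsArbor tl hd G v W) (hw : w ∈ W) :
    DReach tl hd G v w := by
  obtain ⟨s, hs, hr⟩ := h.2.2.2.2 w hw
  exact mem_singleton.1 hs ▸ hr

/-- The elements `s` of `T` whose vertex set `U s` meets `Z`. -/
noncomputable def rootsOn (T : Finset σ) (U : σ → Finset V) (Z : Finset V) : Finset σ :=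
  T.filter fun s => ∃ v ∈ Z, v ∈ U s

theorem mem_rootsOn : s ∈ rootsOn T U Z ↔ s ∈ T ∧ ∃ v ∈ Z, v ∈ U s := by
  simp [rootsOn]

theorem rootsOn_mono (h : X ⊆ Y) : rootsOn T U X ⊆ rootsOn T U Y := fun s hs => by
  obtain ⟨hsT, v, hv, hvU⟩ := mem_rootsOn.1 hs
  exact mem_rootsOn.2 ⟨hsT, v, h hv, hvU⟩

theorem rootsOn_union : rootsOn T U (X ∪ Y) = rootsOn T U X ∪ rootsOn T U Y := by
  ext s
  simp only [mem_rootsOn, mem_union, or_and_right, exists_or, and_or_left]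

theorem rootsOn_singleton : rootsOn T U {v} = T.filter fun s => v ∈ U s := by
  simp [rootsOn]

/-- A packing of arborescences avoiding the arcs of `B` that can possibly be completed by
arcs of `B` to a reachability-based packing. -/
structure IsExtendable (tl hd : α → V) (loc : σ → V) (M : RankFn σ) (T : Finset σ) (B : Finset α)
    (F : σ → Finset α) (U : σ → Finset V) : Prop where
  arbor : ∀ s ∈ T, IsArbor tl hd (F s) (loc s) (U s)
  disjoint : ∀ s ∈ T, ∀ s' ∈ T, s ≠ s' → Disjoint (F s) (F s')
  disjoint_free : ∀ s ∈ T, Disjoint (F s) B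
  indep : ∀ v, M.r (rootsOn T U {v}) = (rootsOn T U {v}).card
  cover : ∀ C Z, IsPetalAt tl hd C Z →
    M.r (SX loc (PReach tl hd C)) ≤ M.r (rootsOn T U Z) + inDegB tl hd B Z

theorem rootsOn_subset (h : ∀ s ∈ T, IsArbor tl hd (F s) (loc s) (U s)) :
    rootsOn T U Z ⊆ SX loc (PReach tl hd Z) := fun s hs => by
  obtain ⟨hsT, v, hv, hvU⟩ := mem_rootsOn.1 hs
  exact mem_SX.2 (mem_PReach.2 ⟨v, hv, ((h s hsT).dReach hvU).mono (subset_univ _)⟩)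

theorem PReach_mono_of_dReach (h : DReach tl hd univ u w) :
    PReach tl hd {u} ⊆ PReach tl hd {w} :=
  PReach_subset inDegB_PReach (mem_PReach_of_dReach h (subset_PReach (mem_singleton_self w)))

/-- In a petal on which the packing is not yet complete, the packing can be augmented along an
arc into the core. -/
theorem IsExtendable.exists_arc (h : IsExtendable tl hd loc M T B F U) (hX : IsPetalAt tl hd C X)
    (htight : M.r (rootsOn T U X) + inDegB tl hd B X ≤ M.r (SX loc (PReach tl hd C)))
    (hlt : M.r (rootsOn T U {w}) < M.r (rootsOn T U X)) (hw : w ∈ X) (hwC : w ∈ C)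
    (hcomp : ∀ u ∈ PReach tl hd C, u ∉ C → ∀ s ∈ SX loc (PReach tl hd {u}),
      M.Spans (rootsOn T U {u}) s) :
    ∃ a ∈ B, tl a ∈ X ∧ hd a ∈ X ∧ hd a ∈ C ∧
      ∃ s ∈ rootsOn T U {tl a}, ¬ M.Spans (rootsOn T U {hd a}) s := by
  by_contra! hcon
  set Y := X.filter fun y => ∀ s ∈ rootsOn T U {y}, M.Spans (rootsOn T U {w}) s with hYdef
  have hmem : ∀ {y}, y ∈ Y ↔ y ∈ X ∧ ∀ s ∈ rootsOn T U {y}, M.Spans (rootsOn T U {w}) s := by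
    simp [hYdef]
  have hstep : ∀ a, tl a ∈ X → hd a ∈ Y → hd a ∉ C → tl a ∈ Y := by
    intro a ha hY hC
    refine hmem.2 ⟨ha, fun s hs => ?_⟩
    refine (hcomp (hd a) (hX.2.2.1 (hmem.1 hY).1) hC s ?_).trans (hmem.1 hY).2
    exact SX_mono (PReach_mono_of_dReach (dReach_arc a)) (rootsOn_subset h.arbor hs)
  have hYpetal : IsPetalAt tl hd C Y := by
    refine ⟨hX.1, ⟨w, mem_inter.2 ⟨hmem.2 ⟨hw, fun s => RankFn.spans_of_mem⟩, hwC⟩⟩,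
      (filter_subset _ _).trans hX.2.2.1, inDegB_eq_zero.2 fun a ha => ?_⟩
    rw [mem_sdiff] at ha ⊢
    have h1 := mem_sdiff.1 (inDegB_eq_zero.1 hX.2.2.2 a (mem_sdiff.2 ⟨(hmem.1 ha.1).1, ha.2⟩))
    exact ⟨hstep a h1.1 ha.1 ha.2, h1.2⟩
  have hdeg : inDegB tl hd B Y ≤ inDegB tl hd B X := by
    refine card_le_card fun a ha => ?_
    rw [mem_filter] at ha ⊢
    refine ⟨ha.1, fun htl => ha.2.1 ?_, (hmem.1 ha.2.2).1⟩
    by_cases hC : hd a ∈ C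
    · refine hmem.2 ⟨htl, fun s hs => ?_⟩
      exact (hcon a ha.1 htl (hmem.1 ha.2.2).1 hC s hs).trans (hmem.1 ha.2.2).2
    · exact hstep a htl ha.2.2 hC
  have hr : M.r (rootsOn T U Y) ≤ M.r (rootsOn T U {w}) := by
    refine RankFn.r_le_of_spans fun s hs => ?_
    obtain ⟨hsT, y, hy, hyU⟩ := mem_rootsOn.1 hs
    exact (hmem.1 hy).2 s (mem_rootsOn.2 ⟨hsT, y, mem_singleton_self y, hyU⟩)
  have := h.cover C Y hYpetal
  omega

theorem IsExtendable.exists_augmenting_arc (h : IsExtendable tl hd loc M T B F U)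
    (hv : M.r (rootsOn T U {v}) < M.r (SX loc (PReach tl hd {v}))) :
    ∃ a ∈ B, ∃ s ∈ T, tl a ∈ U s ∧ ¬ M.Spans (rootsOn T U {hd a}) s ∧
      ∀ C Z, IsPetalAt tl hd C Z → hd a ∈ Z → tl a ∉ Z → M.Spans (rootsOn T U Z) s →
        M.r (SX loc (PReach tl hd C)) < M.r (rootsOn T U Z) + inDegB tl hd B Z := by
  obtain ⟨v, hv, hvmin⟩ := exists_min_image
    (univ.filter fun v => M.r (rootsOn T U {v}) < M.r (SX loc (PReach tl hd {v})))
    (fun v => (PReach tl hd {v}).card) ⟨v, by simpa using hv⟩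
  replace hv := (mem_filter.1 hv).2
  obtain ⟨C, hC, hvC⟩ := exists_atom tl hd v
  have hcomp : ∀ u ∈ PReach tl hd C, u ∉ C → ∀ s ∈ SX loc (PReach tl hd {u}),
      M.Spans (rootsOn T U {u}) s := fun u hu huC s hs => by
    refine RankFn.spans_of_r_le (rootsOn_subset h.arbor) (not_lt.1 fun hlt => ?_) hs
    exact (hvmin u (mem_filter.2 ⟨mem_univ _, hlt⟩)).not_gt (hC.card_PReach_lt hvC hu huC)
  obtain ⟨X, hX, hXmin⟩ := exists_min_image
    (univ.filter fun X => IsPetalAt tl hd C X ∧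
      M.r (rootsOn T U X) + inDegB tl hd B X ≤ M.r (SX loc (PReach tl hd C)) ∧
      ∃ w ∈ X, w ∈ C ∧ M.r (rootsOn T U {w}) < M.r (rootsOn T U X)) card
    ⟨PReach tl hd C, by
      have hdeg : inDegB tl hd B (PReach tl hd C) ≤ inDegB tl hd univ (PReach tl hd C) :=
        card_le_card (filter_subset_filter _ (subset_univ _))
      rw [inDegB_PReach] at hdeg
      have hsub := M.r_mono (rootsOn_subset (Z := PReach tl hd C) h.arbor)
      have hidem : PReach tl hd (PReach tl hd C) = PReach tl hd C :=
        subset_antisymm (fun u hu => by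
          obtain ⟨w, hw, hr⟩ := mem_PReach.1 hu
          exact mem_PReach_of_dReach hr hw) subset_PReach
      have hcov := h.cover C _ hC.isPetalAt_PReach
      rw [hC.PReach_singleton hvC] at hv
      rw [hidem] at hsub
      refine mem_filter.2 ⟨mem_univ _, hC.isPetalAt_PReach, by omega, v, subset_PReach hvC, hvC,
        by omega⟩⟩
  obtain ⟨hXp, hXt, w, hw, hwC, hlt⟩ := (mem_filter.1 hX).2
  obtain ⟨a, haB, htl, hhd, hhdC, s, hs, hns⟩ := h.exists_arc hXp hXt hlt hw hwC hcomp
  obtain ⟨hsT, htlU⟩ : s ∈ T ∧ tl a ∈ U s := by simpa [rootsOn_singleton] using hs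
  refine ⟨a, haB, s, hsT, htlU, hns, fun C' Z hZ hhdZ htlZ hsp => ?_⟩
  by_contra! hZt
  have hhdC' : hd a ∈ C' := by
    by_contra hcon
    exact htlZ (mem_sdiff.1 (inDegB_eq_zero.1 hZ.2.2.2 a (mem_sdiff.2 ⟨hhdZ, hcon⟩))).1
  obtain rfl := hC.eq_of_mem hZ.1 hhdC hhdC'
  have hcap := hXp.inter hZ ⟨hd a, by simp [hhd, hhdZ, hhdC]⟩
  have h1 := h.cover _ _ hcap
  have h2 := h.cover _ _ (hXp.union hZ)
  have h3 := inDegB_submod (tl := tl) (hd := hd) B X Z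
  have hsub : rootsOn T U (X ∩ Z) ⊆ rootsOn T U X ∩ rootsOn T U Z :=
    subset_inter (rootsOn_mono inter_subset_left) (rootsOn_mono inter_subset_right)
  have h4 := M.r_mono hsub
  have h5 := M.r_submod (rootsOn T U X) (rootsOn T U Z)
  rw [rootsOn_union] at h2
  have hspan : M.Spans (rootsOn T U (X ∩ Z)) s :=
    RankFn.spans_of_modular (RankFn.spans_of_mem (rootsOn_mono (singleton_subset_iff.2 htl) hs))
      hsp hsub (by omega)
  have hltr : M.r (rootsOn T U {hd a}) < M.r (rootsOn T U (X ∩ Z)) := by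
    by_contra! hle
    exact hns (hspan.trans fun t ht => RankFn.spans_of_r_le
      (rootsOn_mono (singleton_subset_iff.2 (mem_inter.2 ⟨hhd, hhdZ⟩))) hle ht)
  refine (hXmin (X ∩ Z) (mem_filter.2 ⟨mem_univ _, hcap, by omega, hd a, mem_inter.2 ⟨hhd, hhdZ⟩,
    hhdC, hltr⟩)).not_gt (card_lt_card ⟨inter_subset_left, fun hsub => ?_⟩)
  exact htlZ (mem_inter.1 (hsub htl)).2

theorem IsExtendable.augment (h : IsExtendable tl hd loc M T B F U) (ha : a ∈ B) (hs : s ∈ T)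
    (htl : tl a ∈ U s) (hns : ¬ M.Spans (rootsOn T U {hd a}) s)
    (hstrict : ∀ C Z, IsPetalAt tl hd C Z → hd a ∈ Z → tl a ∉ Z → M.Spans (rootsOn T U Z) s →
        M.r (SX loc (PReach tl hd C)) < M.r (rootsOn T U Z) + inDegB tl hd B Z) :
    IsExtendable tl hd loc M T (B.erase a) (Function.update F s (insert a (F s)))
      (Function.update U s (insert (hd a) (U s))) := by
  have hmem : hd a ∉ U s := fun hU =>
    hns (RankFn.spans_of_mem (by simp [rootsOn_singleton, hs, hU]))
  have hroots : ∀ Z, rootsOn T (Function.update U s (insert (hd a) (U s))) Z =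
      if hd a ∈ Z then insert s (rootsOn T U Z) else rootsOn T U Z := by
    intro Z
    ext t
    by_cases hts : t = s
    · subst hts
      split_ifs with hZ
      · simp only [mem_rootsOn, Function.update_self, mem_insert, true_or, iff_true]
        exact ⟨hs, hd a, hZ, .inl rfl⟩
      · simp only [mem_rootsOn, Function.update_self, mem_insert]
        refine and_congr_right fun _ => exists_congr fun v => and_congr_right fun hv => ?_
        exact or_iff_right (fun he => hZ (he ▸ hv))
    · split_ifs <;> simp [mem_rootsOn, hts]
  have haF : ∀ t ∈ T, a ∉ F t := fun t ht hat => disjoint_left.1 (h.disjoint_free t ht) hat ha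
  constructor
  · intro t ht
    by_cases hts : t = s
    · subst hts
      simpa using (h.arbor t ht).insert htl hmem
    · simpa [hts] using h.arbor t ht
  · intro t ht t' ht' hne
    by_cases hts : t = s
    · subst hts
      simpa [hne.symm, haF t' ht'] using h.disjoint t ht t' ht' hne
    · by_cases hts' : t' = s
      · subst hts'
        simpa [hts, haF t ht] using h.disjoint t ht t' ht' hne
      · simpa [hts, hts'] using h.disjoint t ht t' ht' hne
  · intro t ht
    have := (h.disjoint_free t ht).mono_right (erase_subset a B)
    by_cases hts : t = s
    · subst hts
      simpa using this
    · simpa [hts] using this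
  · intro v
    rw [hroots]
    split_ifs with hv
    · obtain rfl := mem_singleton.1 hv
      rw [RankFn.r_insert_of_not_spans hns, h.indep, card_insert_of_notMem]
      exact fun hm => hns (RankFn.spans_of_mem hm)
    · exact h.indep v
  · intro C Z hZ
    have hcov := h.cover C Z hZ
    by_cases hcase : hd a ∈ Z ∧ tl a ∉ Z
    · have hdeg : inDegB tl hd B Z = inDegB tl hd (B.erase a) Z + 1 := by
        simp only [inDegB]
        rw [filter_erase, card_erase_add_one]
        exact mem_filter.2 ⟨ha, hcase.2, hcase.1⟩
      rw [hroots, if_pos hcase.1]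
      by_cases hsp : M.Spans (rootsOn T U Z) s
      · have := hstrict C Z hZ hcase.1 hcase.2 hsp
        have := M.r_mono (subset_insert s (rootsOn T U Z))
        omega
      · rw [RankFn.r_insert_of_not_spans hsp]
        omega
    · have hdeg : inDegB tl hd (B.erase a) Z = inDegB tl hd B Z := by
        simp only [inDegB]
        rw [filter_erase, erase_eq_of_notMem]
        exact fun hm => hcase ⟨(mem_filter.1 hm).2.2, (mem_filter.1 hm).2.1⟩
      have hle : M.r (rootsOn T U Z) ≤
          M.r (rootsOn T (Function.update U s (insert (hd a) (U s))) Z) := by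
        rw [hroots]
        split_ifs
        exacts [M.r_mono (subset_insert _ _), le_rfl]
      omega

theorem IsExtendable.exists_packing (h : IsExtendable tl hd loc M T B F U) :
    ∃ (F : σ → Finset α) (U : σ → Finset V),
      (∀ s ∈ T, IsArbor tl hd (F s) (loc s) (U s)) ∧
      (∀ s ∈ T, ∀ s' ∈ T, s ≠ s' → Disjoint (F s) (F s')) ∧
      (∀ v : V, IsBasisOf M.r (T.filter fun s => v ∈ U s) (SX loc (PReach tl hd {v}))) := by
  induction B using Finset.strongInduction generalizing F U with
  | H B ih =>
    by_cases hcomp : ∃ v, M.r (rootsOn T U {v}) < M.r (SX loc (PReach tl hd {v}))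
    · obtain ⟨v, hv⟩ := hcomp
      obtain ⟨a, ha, s, hs, htl, hns, hstrict⟩ := h.exists_augmenting_arc hv
      exact ih _ (erase_ssubset ha) (h.augment ha hs htl hns hstrict)
    · push Not at hcomp
      refine ⟨F, U, h.arbor, h.disjoint, fun v => ?_⟩
      rw [← rootsOn_singleton]
      exact ⟨rootsOn_subset h.arbor, h.indep v,
        le_antisymm (M.r_mono (rootsOn_subset h.arbor)) (hcomp v)⟩

end Packing

section Counting

variable {V α σ : Type} [Fintype V] [DecidableEq V] [Fintype α] [DecidableEq α]
  [Fintype σ] [DecidableEq σ] {tl hd : α → V} {loc : σ → V} {M : RankFn σ} {C Z : Finset V}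
  {T : Finset σ} {u v w : V} {F : σ → Finset α} {U : σ → Finset V}

theorem IsArbor.card_add_one {G : Finset α} {W : Finset V} (h : IsArbor tl hd G v W) :
    G.card + 1 = W.card := by
  have hv := h.root_mem
  obtain ⟨-, h2, h3, h4, -⟩ := h
  rw [card_eq_sum_card_fiberwise (f := hd) (t := W) fun a ha => (h2 a ha).2,
    ← add_sum_erase _ _ hv, card_eq_zero.2, zero_add, sum_congr rfl (g := fun _ => 1),
    ← card_eq_sum_ones, card_erase_add_one hv]
  · intro w hw
    rw [mem_erase] at hw
    exact h4 w hw.2 (mem_singleton.not.2 hw.1)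
  · exact filter_eq_empty_iff.2 fun a ha he => h3 a ha (mem_singleton.2 he)

theorem card_packing (hF : ∀ s ∈ T, IsArbor tl hd (F s) (loc s) (U s))
    (hdisj : ∀ s ∈ T, ∀ s' ∈ T, s ≠ s' → Disjoint (F s) (F s'))
    (hb : ∀ v : V, IsBasisOf M.r (T.filter fun s => v ∈ U s) (SX loc (PReach tl hd {v}))) :
    (T.biUnion F).card + T.card = ∑ v : V, M.r (SX loc (PReach tl hd {v})) := by
  rw [card_biUnion hdisj, card_eq_sum_ones T, ← sum_add_distrib,
    sum_congr rfl fun s hs => (hF s hs).card_add_one]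
  simp_rw [← (hb _).2.2, (hb _).2.1, card_filter]
  rw [sum_comm]
  simp

theorem DReach.exists_entering {G : Finset α} (h : DReach tl hd G u w) (hu : u ∉ Z) (hw : w ∈ Z) :
    ∃ a ∈ G, tl a ∉ Z ∧ hd a ∈ Z := by
  induction h with
  | refl => exact absurd hw hu
  | tail _ hstep ih =>
    obtain ⟨a, ha, rfl, rfl⟩ := hstep
    by_cases htl : tl a ∈ Z
    exacts [ih htl, ⟨a, ha, htl, hw⟩]

theorem rank_le_of_packing (hF : ∀ s ∈ T, IsArbor tl hd (F s) (loc s) (U s))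
    (hdisj : ∀ s ∈ T, ∀ s' ∈ T, s ≠ s' → Disjoint (F s) (F s'))
    (hb : ∀ v : V, IsBasisOf M.r (T.filter fun s => v ∈ U s) (SX loc (PReach tl hd {v})))
    (hZ : IsPetalAt tl hd C Z) :
    M.r (SX loc (PReach tl hd C)) ≤ M.r (T ∩ SX loc Z) + inDegB tl hd univ Z := by
  obtain ⟨v, hv⟩ := hZ.2.1
  rw [mem_inter] at hv
  rw [← hZ.1.PReach_singleton hv.2, ← (hb v).2.2]
  set R := (T.filter fun s => v ∈ U s) \ SX loc Z with hR
  have hmem : ∀ s ∈ R, s ∈ T ∧ ∃ a ∈ F s, tl a ∉ Z ∧ hd a ∈ Z := by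
    intro s hs
    rw [hR, mem_sdiff, mem_filter, mem_SX] at hs
    exact ⟨hs.1.1, ((hF s hs.1.1).dReach hs.1.2).exists_entering hs.2 hv.1⟩
  have hcard : R.card ≤ inDegB tl hd univ Z := by
    have hR' : ∀ s : R, ∃ a ∈ F s, tl a ∉ Z ∧ hd a ∈ Z := fun s => (hmem s s.2).2
    choose f hf using hR'
    rw [← card_attach, ← card_image_of_injective _ (f := f) fun s t hst => ?_]
    · exact card_le_card (image_subset_iff.2 fun s _ => mem_filter.2 ⟨mem_univ _, (hf s).2⟩)
    · by_contra hne
      exact disjoint_left.1 (hdisj s (hmem s s.2).1 t (hmem t t.2).1 (Subtype.coe_ne_coe.2 hne))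
        (hf s).1 (hst ▸ (hf t).1)
  have h1 := M.r_mono (show (T.filter fun s => v ∈ U s) ⊆ T ∩ SX loc Z ∪ R by grind)
  have h2 := M.r_submod (T ∩ SX loc Z) R
  have h3 := M.r_le_card R
  omega

end Counting

/-- **Decomposition into an `M`-reachability-based packing of arborescences.**
The arc set of `D` decomposes into an `M`-reachability-based packing of
arborescences iff `d⁻_A(Z) ≥ p̂(Z)` for every petal `Z`, and for every
OW-laminar family `𝒫` of generalized petal bisets,
`Σ_{X∈𝒫} (r_M(S_{P_{X_I}}) − r_M(S_{X_W}) − d⁻_A(X_O)) ≤ Σ_v r_M(S_{P_v}) − |A|`. -/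
theorem decomposition_into_matroid_reachability_based_packing
    {V α σ : Type} [Fintype V] [DecidableEq V] [Fintype α] [DecidableEq α]
    [Fintype σ] [DecidableEq σ]
    (tl hd : α → V) (loc : σ → V) (M : RankFn σ) :
    (∃ (T : Finset σ) (F : σ → Finset α) (U : σ → Finset V),
        (∀ s ∈ T, IsArbor tl hd (F s) (loc s) (U s)) ∧
        (∀ s ∈ T, ∀ s' ∈ T, s ≠ s' → Disjoint (F s) (F s')) ∧
        (∀ v : V, IsBasisOf M.r (T.filter fun s => v ∈ U s)
          (SX loc (PReach tl hd {v}))) ∧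
        (∀ a : α, ∃ s ∈ T, a ∈ F s))
    ↔ ((∀ Z : Finset V, IsPetal tl hd Z →
          phat tl hd loc M Z ≤ (inDegB tl hd univ Z : ℤ)) ∧
       (∀ P : Finset (Finset V × Finset V),
          (∀ X ∈ P, IsPetal tl hd X.1 ∧ X.2.Nonempty ∧
            X.2 ⊆ petalCore tl hd X.1) →
          (∀ X ∈ P, ∀ Y ∈ P, X ≠ Y →
            (petalCore tl hd X.1 ∩ petalCore tl hd Y.1).Nonempty →
            X.1 ⊆ Y.1 \ Y.2 ∨ Y.1 ⊆ X.1 \ X.2) →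
          ∑ X ∈ P, ((M.r (SX loc (PReach tl hd X.2)) : ℤ)
              - M.r (SX loc (X.1 \ X.2)) - inDegB tl hd univ X.1)
            ≤ (∑ v : V, (M.r (SX loc (PReach tl hd {v})) : ℤ))
              - Fintype.card α)) := by
  constructor
  · rintro ⟨T, F, U, hF, hdisj, hb, hA⟩
    have hcard := card_packing hF hdisj hb
    rw [show T.biUnion F = univ from eq_univ_iff_forall.2 fun a => mem_biUnion.2 (hA a),
      card_univ] at hcard
    refine ⟨fun Z hZ => ?_, fun P hP hlam => ?_⟩
    · have h1 := rank_le_of_packing hF hdisj hb hZ.isPetalAt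
      have h2 := M.r_mono (inter_subset_right : T ∩ SX loc Z ⊆ SX loc Z)
      rw [phat, if_pos hZ]
      omega
    · have hterm : ∀ X ∈ P, (M.r (SX loc (PReach tl hd X.2)) : ℤ) - M.r (SX loc (X.1 \ X.2))
          - inDegB tl hd univ X.1 ≤ (T ∩ SX loc X.2).card := fun X hX => by
        obtain ⟨hpet, hne, hsub⟩ := hP X hX
        rw [hpet.isPetalAt.1.PReach_eq hne (hsub.trans inter_subset_left)]
        have h1 := rank_le_of_packing hF hdisj hb hpet.isPetalAt
        have h2 := M.r_mono (show T ∩ SX loc X.1 ⊆ SX loc (X.1 \ X.2) ∪ T ∩ SX loc X.2 by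
          intro s
          simp only [mem_inter, mem_union, mem_SX, mem_sdiff]
          tauto)
        have h3 := M.r_submod (SX loc (X.1 \ X.2)) (T ∩ SX loc X.2)
        have h4 := M.r_le_card (T ∩ SX loc X.2)
        omega
      have hinter : ∀ X ∈ P, ∀ Y ∈ P, X ≠ Y →
          Disjoint (T ∩ SX loc X.2) (T ∩ SX loc Y.2) := by
        intro X hX Y hY hXY
        refine disjoint_left.2 fun s hs ht => ?_
        rw [mem_inter, mem_SX] at hs ht
        have hsX := (hP X hX).2.2 hs.2
        have hsY := (hP Y hY).2.2 ht.2
        rcases hlam X hX Y hY hXY ⟨loc s, mem_inter.2 ⟨hsX, hsY⟩⟩ with h | h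
        · exact (mem_sdiff.1 (h (mem_inter.1 hsX).2)).2 ht.2
        · exact (mem_sdiff.1 (h (mem_inter.1 hsY).2)).2 hs.2
      have hle : ∑ X ∈ P, (T ∩ SX loc X.2).card ≤ T.card := by
        rw [← card_biUnion hinter]
        exact card_le_card (biUnion_subset.2 fun _ _ => inter_subset_left)
      refine (sum_le_sum hterm).trans ?_
      rw [← Nat.cast_sum, ← Nat.cast_sum]
      omega
  · rintro ⟨hpet, hfam⟩
    have hbdd : (petalSystem tl hd loc M).Bounded M loc ∅ ∅ 1
        ((∑ v : V, (M.r (SX loc (PReach tl hd {v})) : ℤ)) - Fintype.card α) := by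
      refine CoreSystem.bounded_of_laminar (fun Z hZ => ?_) fun P hP hlam => ?_
      · have h := hpet Z hZ
        rw [phat, if_pos (show IsPetal tl hd Z from hZ)] at h
        simp only [petalSystem]
        omega
      · refine le_trans (le_of_eq (sum_congr rfl fun X hX => ?_)) (hfam P hP hlam)
        obtain ⟨hX, hne, hsub⟩ := hP X hX
        rw [hX.isPetalAt.1.PReach_eq hne (hsub.trans inter_subset_left)]
        simp only [petalSystem]
        ring
    obtain ⟨T₀, -, hcard₀, hT₀⟩ := hbdd.exists_cover
    obtain ⟨T, hTT₀, hT, hind⟩ := exists_independent_cover (T := T₀) (loc := loc) (M := M)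
      (IsPetal tl hd) (petalSystem tl hd loc M).demand fun Z hZ => demand_le_of_cover hT₀ hZ
    have hroots : ∀ Z, rootsOn T (fun s => {loc s}) Z = T ∩ SX loc Z := by
      intro Z
      ext s
      simp [mem_rootsOn, mem_SX]
    have hext : IsExtendable tl hd loc M T univ (fun _ => ∅) (fun s => {loc s}) := by
      refine ⟨fun s _ => isArbor_singleton tl hd (loc s), by simp, by simp, fun v => ?_,
        fun C Z hZ => ?_⟩
      · rw [hroots]
        exact hind v
      · have h := hT Z hZ.isPetal
        simp only [petalSystem, hZ.petalAtom_eq] at h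
        rw [hroots]
        omega
    obtain ⟨F, U, hF, hdisj, hb⟩ := hext.exists_packing
    refine ⟨T, F, U, hF, hdisj, hb, fun a => mem_biUnion.1 ?_⟩
    have hcount := card_packing hF hdisj hb
    have hle := card_le_card hTT₀
    rw [sdiff_empty, ← Nat.cast_sum] at hcard₀
    rw [eq_univ_of_card (T.biUnion F) (le_antisymm (card_le_univ _) (by omega))]
    exact mem_univ a
end

section
/- Let D=(V,A) be a digraph, S a multiset of vertices in V, and M a matroid on S with rank function r_M. Then the condition r_M(S_Z) + d⁻_A(Z) ≥ r_M(S) holds for every non-empty subset Z of V if and only if the condition r_M(S_X) + d⁻_A(X) ≥ r_M(S) holds for every subatom X of D. -/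
open Finset

attribute [local instance] Classical.propDecidable

lemma SX_mono_s10 {V σ : Type} [DecidableEq V] [Fintype σ] (loc : σ → V)
    {X Z : Finset V} (h : X ⊆ Z) : SX loc X ⊆ SX loc Z := by
  intro s hs
  simp only [SX, mem_filter, mem_univ, true_and] at hs ⊢
  exact h hs

/-- Every non-empty vertex set `Z` contains a subatom that no arc from the rest of `Z` enters. -/
lemma exists_isSubatom_subset_of_nonempty {V α : Type} [Fintype α] (tl hd : α → V)
    {Z : Finset V} (hZ : Z.Nonempty) :
    ∃ X ⊆ Z, IsSubatom tl hd X ∧ ∀ a, hd a ∈ X → tl a ∈ Z → tl a ∈ X := by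
  obtain ⟨v, hvZ, hmin⟩ :=
    exists_min_image Z (fun v => (Z.filter fun u => DReach tl hd univ u v).card) hZ
  have hv : v ∈ Z.filter fun u => DReach tl hd univ u v :=
    mem_filter.2 ⟨hvZ, Relation.ReflTransGen.refl⟩
  refine ⟨Z.filter fun u => DReach tl hd univ u v, filter_subset _ _, ⟨⟨v, hv⟩, ?_⟩, ?_⟩
  · intro u hu w hw
    obtain ⟨hwZ, hwv⟩ := mem_filter.1 hw
    have hsub : (Z.filter fun x => DReach tl hd univ x w) ⊆
        Z.filter fun x => DReach tl hd univ x v := fun x hx =>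
      mem_filter.2 ⟨(mem_filter.1 hx).1, (mem_filter.1 hx).2.trans hwv⟩
    have heq := eq_of_subset_of_card_le hsub (hmin w hwZ)
    rw [← heq] at hu
    exact (mem_filter.1 hu).2
  · intro a ha hta
    exact mem_filter.2 ⟨hta, (mem_filter.1 ha).2.head ⟨a, mem_univ a, rfl, rfl⟩⟩

/-- The condition `r_M(S_Z) + d⁻_A(Z) ≥ r_M(S)` holds for every non-empty
`Z ⊆ V` iff it holds for every subatom of `D`. -/
theorem rank_indeg_condition_iff_subatoms
    {V α σ : Type} [Fintype V] [DecidableEq V] [Fintype α] [DecidableEq α]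
    [Fintype σ] [DecidableEq σ]
    (tl hd : α → V) (loc : σ → V) (M : RankFn σ) :
    (∀ Z : Finset V, Z.Nonempty →
        M.r univ ≤ M.r (SX loc Z) + inDegB tl hd univ Z)
    ↔ (∀ X : Finset V, IsSubatom tl hd X →
        M.r univ ≤ M.r (SX loc X) + inDegB tl hd univ X) := by
  refine ⟨fun h X hX => h X hX.1, fun h Z hZ => ?_⟩
  obtain ⟨X, hXZ, hX, hclosed⟩ := exists_isSubatom_subset_of_nonempty tl hd hZ
  refine (h X hX).trans (Nat.add_le_add (M.r_mono (SX_mono_s10 loc hXZ)) (card_le_card ?_))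
  intro a ha
  obtain ⟨-, hta, hha⟩ := mem_filter.1 ha
  exact mem_filter.2 ⟨mem_univ a, fun ht => hta (hclosed a hha ht), hXZ hha⟩
end

section
/- Let D=(V,A) be a digraph, S a multiset of vertices in V, and M a matroid on S with rank function r_M. If for every subatom X of D one has r_M(S_X) + d⁻_A(X) ≥ r_M(S), then for every non-empty Z ⊆ V with d⁻_A(Z) = 0 one has r_M(S_Z) ≥ r_M(S). -/
open Finset

attribute [local instance] Classical.propDecidable

theorem mem_PReach_singleton {V α : Type} [Fintype V] [Fintype α] (tl hd : α → V) {u v : V} :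
    u ∈ PReach tl hd {v} ↔ DReach tl hd univ u v := by
  simp [PReach]

/-- A set without entering arcs contains all vertices that reach it. -/
theorem mem_of_DReach_of_inDegB_eq_zero {V α : Type} [DecidableEq V] [Fintype α]
    {tl hd : α → V} {Z : Finset V} (hZ : inDegB tl hd univ Z = 0) {u v : V}
    (huv : DReach tl hd univ u v) (hv : v ∈ Z) : u ∈ Z := by
  induction huv using Relation.ReflTransGen.head_induction_on with
  | refl => exact hv
  | head hstep _ ih =>
    obtain ⟨a, ha, rfl, rfl⟩ := hstep
    by_contra hu
    rw [inDegB, card_eq_zero, filter_eq_empty_iff] at hZ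
    exact hZ ha ⟨hu, ih⟩

/-- No arc enters the set of vertices that reach a given vertex. -/
theorem inDegB_PReach_singleton {V α : Type} [Fintype V] [DecidableEq V] [Fintype α]
    (tl hd : α → V) (v : V) : inDegB tl hd univ (PReach tl hd {v}) = 0 := by
  rw [inDegB, card_eq_zero, filter_eq_empty_iff]
  rintro a ha ⟨hu, hw⟩
  rw [mem_PReach_singleton] at hu hw
  exact hu (hw.head ⟨a, ha, rfl, rfl⟩)

/-- A non-empty set without entering arcs contains a subatom without entering arcs. -/
theorem exists_subatom_inDegB_eq_zero {V α : Type} [Fintype V] [DecidableEq V] [Fintype α]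
    {tl hd : α → V} {Z : Finset V} (hne : Z.Nonempty) (hZ : inDegB tl hd univ Z = 0) :
    ∃ X ⊆ Z, IsSubatom tl hd X ∧ inDegB tl hd univ X = 0 := by
  obtain ⟨v, hv, hmin⟩ := exists_min_image Z (fun v => (PReach tl hd {v}).card) hne
  have hsub : PReach tl hd {v} ⊆ Z := fun u hu =>
    mem_of_DReach_of_inDegB_eq_zero hZ ((mem_PReach_singleton tl hd).1 hu) hv
  have hself : v ∈ PReach tl hd {v} := (mem_PReach_singleton tl hd).2 .refl
  refine ⟨_, hsub, ⟨⟨v, hself⟩, fun u hu w hw => ?_⟩, inDegB_PReach_singleton tl hd v⟩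
  have hwv := (mem_PReach_singleton tl hd).1 hw
  have hle : PReach tl hd {w} ⊆ PReach tl hd {v} := fun x hx =>
    (mem_PReach_singleton tl hd).2 (((mem_PReach_singleton tl hd).1 hx).trans hwv)
  rw [← eq_of_subset_of_card_le hle (hmin w (hsub hw))] at hu
  exact (mem_PReach_singleton tl hd).1 hu

/-- If `r_M(S_X) + d⁻_A(X) ≥ r_M(S)` for every subatom `X` of `D`, then every
non-empty `Z ⊆ V` with `d⁻_A(Z) = 0` satisfies `r_M(S_Z) ≥ r_M(S)`. -/
theorem rank_ge_of_no_entering_arc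
    {V α σ : Type} [Fintype V] [DecidableEq V] [Fintype α] [DecidableEq α]
    [Fintype σ] [DecidableEq σ]
    (tl hd : α → V) (loc : σ → V) (M : RankFn σ)
    (h : ∀ X : Finset V, IsSubatom tl hd X →
        M.r univ ≤ M.r (SX loc X) + inDegB tl hd univ X) :
    ∀ Z : Finset V, Z.Nonempty → inDegB tl hd univ Z = 0 →
      M.r univ ≤ M.r (SX loc Z) := by
  intro Z hne hZ
  obtain ⟨X, hXZ, hX, hdeg⟩ := exists_subatom_inDegB_eq_zero hne hZ
  have hrank := h X hX
  rw [hdeg, add_zero] at hrank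
  exact hrank.trans (M.r_mono (monotone_filter_right _ fun _ _ hs => hXZ hs))
end
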